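/- arXiv:1601.02320 — 2 statements merged into one kernel-verified Lean document; each statement's English description precedes it below -/
import Mathlib

section
/- Suppose p ≡ 3 (mod 4) and m is even. Then CWE(C_D) = w_0^{(p−1)p^{m−1}/2} + (p^{m−1}−1)·Π_{ρ∈F_p} w_ρ^{(p−1)p^{m−2}/2} + ((p−1)/4)(p^{m−1}+p^{(m−2)/2}) · w_0^{((p−1)/2)(p^{m−2}−p^{(m−2)/2})} · Σ_{i∈{1,−1}} [Π_{ρ∈F_p^*, η̄(ρ)=i} w_ρ^{(p−1)p^{m−2}/2}] · [Π_{z∈F_p^*, η̄(z)=−i} w_z^{(p−1)p^{m−2}/2 + p^{(m−2)/2}}] + ((p−1)/4)(p^{m−1}−p^{(m−2)/2}) · w_0^{((p−1)/2)(p^{m−2}+p^{(m−2)/2})} · Σ_{i∈{1,−1}} [Π_{ρ∈F_p^*, η̄(ρ)=i} w_ρ^{(p−1)p^{m−2}/2}] · [Π_{z∈F_p^*, η̄(z)=−i} w_z^{(p−1)p^{m−2}/2 − p^{(m−2)/2}}]. -/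
open MvPolynomial

/-- `N_a(ρ) = #{x ∈ D : Tr(a x²) = ρ}` where `D = {x ∈ F_r^* : Tr(x) ∈ Sq}`. -/
noncomputable def Nfun (p : ℕ) (F : Type) [Field F] [Algebra (ZMod p) F]
    (a : F) (ρ : ZMod p) : ℕ :=
  Set.ncard {x : F | (x ≠ 0 ∧ IsSquare (Algebra.trace (ZMod p) F x) ∧
    Algebra.trace (ZMod p) F x ≠ 0) ∧ Algebra.trace (ZMod p) F (a * x ^ 2) = ρ}

/-- The complete weight enumerator `CWE(C_D) = Σ_{a ∈ F_r} Π_{ρ ∈ F_p} w_ρ^{N_a(ρ)}`,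
an element of `ℤ[w_ρ : ρ ∈ F_p]`. -/
noncomputable def CWE (p : ℕ) [NeZero p] (F : Type) [Field F] [Fintype F]
    [Algebra (ZMod p) F] : MvPolynomial (ZMod p) ℤ :=
  ∑ a : F, ∏ ρ : ZMod p, (X ρ : MvPolynomial (ZMod p) ℤ) ^ (Nfun p F a ρ)

section helpers
set_option linter.unusedSectionVars false
variable {p : ℕ} [Fact p.Prime] {F : Type} [Field F] [Fintype F] [Algebra (ZMod p) F]
  [DecidableEq F]

local notation "tr" => Algebra.trace (ZMod p) F

lemma shift_count (S : Finset F) (f : F → ZMod p) (w : F) (k : ZMod p) (hk : k ≠ 0)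
    (hS : ∀ x ∈ S, ∀ t : ZMod p, x + t • w ∈ S ∧ f (x + t • w) = f x + t * k) (ρ : ZMod p) :
    p * (S.filter (fun x => f x = ρ)).card = S.card := by
  have key : ∀ σ, (S.filter (fun x => f x = σ)).card = (S.filter (fun x => f x = ρ)).card := by
    intro σ
    refine Finset.card_nbij' (fun x => x + ((ρ - σ) / k) • w) (fun x => x + ((σ - ρ) / k) • w)
      ?_ ?_ ?_ ?_
    · intro x hx
      simp only [Finset.coe_filter, Set.mem_ofPred_eq] at hx ⊢
      refine ⟨(hS x hx.1 _).1, ?_⟩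
      rw [(hS x hx.1 _).2, hx.2]; field_simp; ring
    · intro x hx
      simp only [Finset.coe_filter, Set.mem_ofPred_eq] at hx ⊢
      refine ⟨(hS x hx.1 _).1, ?_⟩
      rw [(hS x hx.1 _).2, hx.2]; field_simp; ring
    · intro x hx
      simp only [add_assoc, ← add_smul]
      rw [show (ρ - σ) / k + (σ - ρ) / k = 0 by ring]; simp
    · intro x hx
      simp only [add_assoc, ← add_smul]
      rw [show (σ - ρ) / k + (ρ - σ) / k = 0 by ring]; simp
  have h := Finset.card_eq_sum_card_fiberwise (f := f) (s := S) (t := Finset.univ)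
    (fun _ _ => by simp)
  rw [h, Finset.sum_congr rfl (fun σ _ => key σ)]
  simp [ZMod.card]

lemma exists_tr (b : F) (hb : b ≠ 0) : ∃ w : F, tr (b * w) = 1 := by
  obtain ⟨x, hx⟩ := Algebra.trace_surjective (ZMod p) F 1
  exact ⟨b⁻¹ * x, by rw [mul_inv_cancel_left₀ hb, hx]⟩

lemma tr_mul_smul (b w : F) (t : ZMod p) : tr (b * (t • w)) = t * tr (b * w) := by
  rw [mul_smul_comm, map_smul, smul_eq_mul]

lemma card_tr_mul (b : F) (hb : b ≠ 0) (ρ : ZMod p) :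
    p * (Finset.univ.filter (fun x : F => tr (b * x) = ρ)).card = Fintype.card F := by
  obtain ⟨w, hw⟩ := exists_tr (p := p) b hb
  refine shift_count Finset.univ (fun x => tr (b * x)) w 1 one_ne_zero ?_ ρ
  intro x _ t
  refine ⟨by simp, ?_⟩
  rw [mul_add, map_add, tr_mul_smul, hw]

lemma card_tr (ρ : ZMod p) :
    p * (Finset.univ.filter (fun x : F => tr x = ρ)).card = Fintype.card F := by
  simpa using card_tr_mul (p := p) (F := F) 1 one_ne_zero ρ

/-- Two independent functionals. -/
lemma card_ker_tr_mul (b : F) (hb : ∀ k : ZMod p, b ≠ algebraMap (ZMod p) F k) (ρ : ZMod p) :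
    p * ((Finset.univ.filter (fun x : F => tr x = 0)).filter (fun x : F => tr (b * x) = ρ)).card
      = (Finset.univ.filter (fun x : F => tr x = 0)).card := by
  obtain ⟨w, hw0, hw⟩ : ∃ w : F, tr w = 0 ∧ tr (b * w) ≠ 0 := by
    by_contra! hcon
    obtain ⟨e, he⟩ := Algebra.trace_surjective (ZMod p) F 1
    have h1 := hb (tr (b * e))
    obtain ⟨x, hx⟩ := exists_tr (p := p) _ (sub_ne_zero.mpr h1)
    have h2 := hcon (x - tr x • e) (by rw [map_sub, map_smul, he]; simp)
    rw [mul_sub, map_sub, tr_mul_smul] at h2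
    rw [sub_mul, map_sub, ← Algebra.smul_def, map_smul, smul_eq_mul] at hx
    have : (0 : ZMod p) = 1 := by rw [← hx, ← h2]; ring
    exact zero_ne_one this
  refine shift_count _ (fun x => tr (b * x)) w (tr (b * w)) hw ?_ ρ
  intro x hx t
  simp only [Finset.mem_filter, Finset.mem_univ, true_and] at hx ⊢
  refine ⟨by rw [map_add, map_smul, hx, hw0]; simp, ?_⟩
  rw [mul_add, map_add, tr_mul_smul]

/-- pairs counting -/
lemma sq_count (hp2 : (2 : ZMod p) ≠ 0) (V : Finset F) (a : F)
    (hadd : ∀ x ∈ V, ∀ y ∈ V, x + y ∈ V) (hsub : ∀ x ∈ V, ∀ y ∈ V, x - y ∈ V)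
    (hsm : ∀ x ∈ V, ∀ t : ZMod p, t • x ∈ V) :
    ∑ ρ : ZMod p, (V.filter (fun x => tr (a * x ^ 2) = ρ)).card ^ 2
      = ∑ u ∈ V, (V.filter (fun v => tr (a * u * v) = 0)).card := by
  have e1 : ∑ ρ : ZMod p, (V.filter (fun x => tr (a * x ^ 2) = ρ)).card ^ 2
      = ((V ×ˢ V).filter (fun z => tr (a * z.1 ^ 2) = tr (a * z.2 ^ 2))).card := by
    rw [Finset.card_eq_sum_card_fiberwise (f := fun z : F × F => tr (a * z.1 ^ 2))
      (t := Finset.univ) (fun _ _ => by simp)]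
    refine Finset.sum_congr rfl fun ρ _ => ?_
    rw [sq, ← Finset.card_product]
    congr 1
    ext ⟨x, y⟩
    simp only [Finset.mem_product, Finset.mem_filter]
    constructor
    · rintro ⟨⟨h1, h2⟩, h3, h4⟩; exact ⟨⟨⟨h1, h3⟩, by rw [h2, h4]⟩, h2⟩
    · rintro ⟨⟨⟨h1, h3⟩, h4⟩, h2⟩; exact ⟨⟨h1, h2⟩, h3, by rw [← h4, h2]⟩
  have e2 : ∑ u ∈ V, (V.filter (fun v => tr (a * u * v) = 0)).card
      = ((V ×ˢ V).filter (fun z => tr (a * z.1 * z.2) = 0)).card := by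
    simp only [Finset.card_filter, Finset.sum_product]
  rw [e1, e2]
  have h2F : (algebraMap (ZMod p) F 2⁻¹) * 2 = 1 := by
    rw [← map_ofNat (algebraMap (ZMod p) F) 2, ← map_mul, inv_mul_cancel₀ hp2, map_one]
  refine Finset.card_nbij' (fun z => (z.1 - z.2, z.1 + z.2))
    (fun z => ((2⁻¹ : ZMod p) • (z.1 + z.2), (2⁻¹ : ZMod p) • (z.2 - z.1))) ?_ ?_ ?_ ?_
  · rintro ⟨x, y⟩ h
    simp only [Finset.coe_filter, Finset.mem_product, Set.mem_ofPred_eq] at h ⊢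
    refine ⟨⟨hsub _ h.1.1 _ h.1.2, hadd _ h.1.1 _ h.1.2⟩, ?_⟩
    rw [show a * (x - y) * (x + y) = a * x ^ 2 - a * y ^ 2 by ring, map_sub, h.2, sub_self]
  · rintro ⟨u, v⟩ h
    simp only [Finset.coe_filter, Finset.mem_product, Set.mem_ofPred_eq] at h ⊢
    refine ⟨⟨hsm _ (hadd _ h.1.1 _ h.1.2) _, hsm _ (hsub _ h.1.2 _ h.1.1) _⟩, ?_⟩
    rw [← sub_eq_zero, ← map_sub]
    have : a * ((2⁻¹ : ZMod p) • (u + v)) ^ 2 - a * ((2⁻¹ : ZMod p) • (v - u)) ^ 2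
        = a * u * v := by
      simp only [Algebra.smul_def]
      linear_combination a * u * v * (algebraMap (ZMod p) F 2⁻¹ * 2 + 1) * h2F
    rw [this, h.2]
  · rintro ⟨x, y⟩ h
    simp only [Algebra.smul_def, Prod.mk.injEq]
    exact ⟨by linear_combination x * h2F, by linear_combination y * h2F⟩
  · rintro ⟨x, y⟩ h
    simp only [Algebra.smul_def, Prod.mk.injEq]
    exact ⟨by linear_combination x * h2F, by linear_combination y * h2F⟩

/-- character sums over trace fibres -/
noncomputable def Tsum (p : ℕ) (F : Type) [Field F] [Fintype F] [Algebra (ZMod p) F]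
    [DecidableEq F] (ρ : ZMod p) : ℤ :=
  ∑ y ∈ Finset.univ.filter (fun y : F => Algebra.trace (ZMod p) F y = ρ), quadraticChar F y

lemma card_quad (hF : ringChar F ≠ 2) (a : F) (ha : a ≠ 0) (ρ : ZMod p) :
    ((Finset.univ.filter (fun x : F => tr (a * x ^ 2) = ρ)).card : ℤ)
      = (Finset.univ.filter (fun x : F => tr x = ρ)).card + quadraticChar F a * Tsum p F ρ := by
  rw [Finset.card_eq_sum_card_fiberwise (f := fun x : F => a * x ^ 2)
    (t := Finset.univ.filter (fun x : F => tr x = ρ)) (fun x hx => by simpa using hx)]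
  rw [Tsum, Finset.mul_sum, Finset.card_eq_sum_ones]
  push_cast
  rw [← Finset.sum_add_distrib]
  refine Finset.sum_congr rfl fun y hy => ?_
  have h := quadraticChar_card_sqrts hF (a⁻¹ * y)
  have h3 : quadraticChar F a⁻¹ = quadraticChar F a := by
    have h4 : quadraticChar F a * quadraticChar F a⁻¹ = 1 := by
      rw [← map_mul, mul_inv_cancel₀ ha, map_one]
    rcases quadraticChar_dichotomy ha with h5 | h5 <;> rw [h5] at h4 ⊢ <;> linarith
  rw [map_mul, h3] at h
  rw [add_comm, ← h]
  congr 2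
  ext x
  simp only [Finset.mem_filter, Finset.mem_univ, true_and, Set.mem_toFinset, Set.mem_ofPred_eq] at hy ⊢
  constructor
  · rintro ⟨_, h2⟩; rw [← h2, inv_mul_cancel_left₀ ha]
  · intro h2; rw [h2, mul_inv_cancel_left₀ ha]; exact ⟨hy, rfl⟩

lemma Tsum_mul (hsq : ∀ t : ZMod p, t ≠ 0 → quadraticChar F (algebraMap (ZMod p) F t) = 1)
    (t : ZMod p) (ht : t ≠ 0) : Tsum p F t = Tsum p F 1 := by
  unfold Tsum
  refine Finset.sum_nbij' (fun y => t⁻¹ • y) (fun y => t • y) ?_ ?_ ?_ ?_ ?_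
  · intro y hy; simp at hy ⊢; rw [hy, inv_mul_cancel₀ ht]
  · intro y hy; simp at hy ⊢; rw [hy, mul_one]
  · intro y _; rw [smul_smul, mul_inv_cancel₀ ht, one_smul]
  · intro y _; rw [smul_smul, inv_mul_cancel₀ ht, one_smul]
  · intro y _; rw [Algebra.smul_def, map_mul, hsq _ (inv_ne_zero ht), one_mul]

lemma sum_zmod_split {M : Type*} [AddCommMonoid M] (f : ZMod p → M) (c : M)
    (h : ∀ t, t ≠ 0 → f t = c) : ∑ t, f t = f 0 + (p - 1) • c := by
  rw [← Finset.add_sum_erase _ _ (Finset.mem_univ (0 : ZMod p))]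
  congr 1
  rw [Finset.sum_congr rfl (fun t ht => h t (Finset.ne_of_mem_erase ht))]
  simp [ZMod.card]

lemma Tsum_zero (hF : ringChar F ≠ 2)
    (hsq : ∀ t : ZMod p, t ≠ 0 → quadraticChar F (algebraMap (ZMod p) F t) = 1) :
    Tsum p F 0 = - (((p : ℤ) - 1) * Tsum p F 1) := by
  have h : ∑ ρ : ZMod p, Tsum p F ρ = 0 := by
    unfold Tsum
    rw [Finset.sum_fiberwise_of_maps_to (fun _ _ => Finset.mem_univ _)]
    exact quadraticChar_sum_zero hF
  rw [sum_zmod_split _ _ (Tsum_mul hsq)] at h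
  have hp := (Fact.out : p.Prime).one_lt
  rw [nsmul_eq_mul, Nat.cast_sub hp.le] at h
  push_cast at h
  linarith

lemma hsq_of_card (P k : ℕ) (hP : P = p ^ k) (hF : ringChar F ≠ 2) (hodd : P % 2 = 1)
    (hc : Fintype.card F = P * P) (t : ZMod p) (ht : t ≠ 0) :
    quadraticChar F (algebraMap (ZMod p) F t) = 1 := by
  have h0 : algebraMap (ZMod p) F t ≠ 0 := by simpa using ht
  rw [quadraticChar_one_iff_isSquare h0, FiniteField.isSquare_iff hF h0, hc, ← map_pow]
  obtain ⟨j, hj⟩ : ∃ j, P = 2 * j + 1 := ⟨P / 2, by omega⟩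
  have e : P * P / 2 = (2 * j) * (j + 1) := by
    have : P * P = 2 * ((2 * j) * (j + 1)) + 1 := by rw [hj]; ring
    omega
  have h1 : t ^ (2 * j) = 1 := by
    have h2 : t ^ P = t := by rw [hP]; exact ZMod.pow_card_pow t
    rw [hj, pow_succ] at h2
    exact mul_right_cancel₀ ht (by rw [h2, one_mul])
  rw [e, pow_mul, h1, one_pow, map_one]

lemma card_tr_val {q : ℕ} (hc : Fintype.card F = p * p * (q * q)) (ρ : ZMod p) :
    (Finset.univ.filter (fun x : F => tr x = ρ)).card = p * (q * q) := by
  have h := card_tr (F := F) ρ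
  rw [hc, mul_assoc] at h
  exact Nat.eq_of_mul_eq_mul_left (Fact.out : p.Prime).pos h

lemma Tsum_sq {q : ℕ} (hc : Fintype.card F = p * p * (q * q)) (hF : ringChar F ≠ 2)
    (hp2 : (2 : ZMod p) ≠ 0)
    (hsq : ∀ t : ZMod p, t ≠ 0 → quadraticChar F (algebraMap (ZMod p) F t) = 1) :
    Tsum p F 1 ^ 2 = (q : ℤ) ^ 2 := by
  have hp := (Fact.out : p.Prime).one_lt
  have h := sq_count (p := p) hp2 (Finset.univ : Finset F) 1 (by simp) (by simp) (by simp)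
  have hr : ∑ u : F, (Finset.univ.filter (fun v : F => tr (1 * u * v) = 0)).card
      = p * p * (q * q) + (p * p * (q * q) - 1) * (p * (q * q)) := by
    rw [← Finset.add_sum_erase _ _ (Finset.mem_univ (0 : F))]
    congr 1
    · simp [← hc]
    · rw [Finset.sum_congr rfl (g := fun _ => p * (q * q))]
      · simp [hc]
      · intro u hu
        have hu := Finset.ne_of_mem_erase hu
        have h1 := card_tr_mul (p := p) u hu 0
        rw [hc, mul_assoc] at h1
        simp only [one_mul]
        exact Nat.eq_of_mul_eq_mul_left (Fact.out : p.Prime).pos h1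
  rw [hr] at h
  have hz := congrArg (Nat.cast : ℕ → ℤ) h
  have hpos : 1 ≤ p * p * (q * q) := by rw [← hc]; exact Fintype.card_pos
  push_cast [Nat.cast_sub hpos] at hz
  simp only [card_quad hF (1 : F) one_ne_zero, card_tr_val hc] at hz
  simp only [map_one, one_mul] at hz
  rw [sum_zmod_split _ (((p * (q * q) : ℕ) + Tsum p F 1 : ℤ) ^ 2)
    (fun t ht => by rw [Tsum_mul hsq t ht]), Tsum_zero hF hsq, nsmul_eq_mul,
    Nat.cast_sub hp.le] at hz
  push_cast at hz
  have hp0 : (p : ℤ) * (p - 1) ≠ 0 := by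
    have : (1 : ℤ) < p := by exact_mod_cast hp
    exact mul_ne_zero (by linarith) (by linarith)
  apply mul_left_cancel₀ hp0
  linear_combination hz

/-- number of `x` in the trace-zero hyperplane with `Tr(a x²) = ρ` -/
noncomputable def hcount (p : ℕ) (F : Type) [Field F] [Fintype F] [Algebra (ZMod p) F]
    [DecidableEq F] (a : F) (ρ : ZMod p) : ℕ :=
  ((Finset.univ.filter (fun x : F => Algebra.trace (ZMod p) F x = 0)).filter
    (fun x : F => Algebra.trace (ZMod p) F (a * x ^ 2) = ρ)).card

lemma tr_quad_smul (a x : F) (s : ZMod p) : tr (a * (s • x) ^ 2) = s ^ 2 * tr (a * x ^ 2) := by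
  rw [smul_pow, mul_smul_comm, map_smul, smul_eq_mul]

lemma hcount_scale (a : F) (ρ s : ZMod p) (hs : s ≠ 0) :
    hcount p F a (s ^ 2 * ρ) = hcount p F a ρ := by
  unfold hcount
  refine Finset.card_nbij' (fun y => s⁻¹ • y) (fun y => s • y) ?_ ?_ ?_ ?_
  · intro y hy
    simp only [Finset.coe_filter, Finset.mem_filter, Finset.mem_univ, true_and,
      Set.mem_ofPred_eq] at hy ⊢
    rw [tr_quad_smul, hy.2, map_smul, hy.1]
    exact ⟨by simp, by field_simp⟩
  · intro y hy
    simp only [Finset.coe_filter, Finset.mem_filter, Finset.mem_univ, true_and,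
      Set.mem_ofPred_eq] at hy ⊢
    rw [tr_quad_smul, hy.2, map_smul, hy.1]
    exact ⟨by simp, rfl⟩
  · intro y _; simp only [smul_smul, mul_inv_cancel₀ hs, one_smul]
  · intro y _; simp only [smul_smul, inv_mul_cancel₀ hs, one_smul]

lemma tr_quad_shift (a : F) (ha : a ≠ 0) (x : F) (t : ZMod p) :
    tr (a * (x + t • a⁻¹) ^ 2) = tr (a * x ^ 2) + 2 * t * tr x + t ^ 2 * tr a⁻¹ := by
  have : a * (x + t • a⁻¹) ^ 2 = a * x ^ 2 + (2 * t) • x + (t ^ 2) • a⁻¹ := by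
    simp only [Algebra.smul_def, map_mul, map_pow, map_ofNat]
    field_simp
    ring
  rw [this, map_add, map_add, map_smul, map_smul, smul_eq_mul, smul_eq_mul]

lemma fib_count (a : F) (ρ : ZMod p) :
    (Finset.univ.filter (fun x : F => tr (a * x ^ 2) = ρ)).card
     = ∑ s : ZMod p, ((Finset.univ.filter (fun x : F => tr x = s)).filter
        (fun x : F => tr (a * x ^ 2) = ρ)).card := by
  rw [Finset.card_eq_sum_card_fiberwise (f := fun x : F => tr x) (t := Finset.univ)
    (fun _ _ => by simp)]
  refine Finset.sum_congr rfl fun s _ => ?_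
  rw [Finset.filter_comm]

lemma n_zero (a : F) (ha : a ≠ 0) (hτ : tr a⁻¹ ≠ 0) :
    (Finset.univ.filter (fun x : F => tr (a * x ^ 2) = 0)).card
      = hcount p F a 0 + (p - 1) * hcount p F a (- tr a⁻¹) := by
  rw [fib_count, sum_zmod_split _ (hcount p F a (- tr a⁻¹)), smul_eq_mul]
  · rfl
  intro s hs
  have ht : s / tr a⁻¹ ≠ 0 := div_ne_zero hs hτ
  rw [← hcount_scale a _ _ ht]
  unfold hcount
  refine Finset.card_nbij' (fun x => x + (-(s / tr a⁻¹)) • a⁻¹) (fun x => x + (s / tr a⁻¹) • a⁻¹)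
    ?_ ?_ ?_ ?_
  · intro y hy
    simp only [Finset.coe_filter, Finset.mem_filter, Finset.mem_univ, true_and,
      Set.mem_ofPred_eq] at hy ⊢
    rw [tr_quad_shift a ha, hy.2, map_add, map_smul, hy.1, smul_eq_mul]
    exact ⟨by rw [neg_mul, div_mul_cancel₀ _ hτ]; ring, by field_simp; ring⟩
  · intro y hy
    simp only [Finset.coe_filter, Finset.mem_filter, Finset.mem_univ, true_and,
      Set.mem_ofPred_eq] at hy ⊢
    rw [tr_quad_shift a ha, hy.2, map_add, map_smul, hy.1, smul_eq_mul]
    exact ⟨by rw [div_mul_cancel₀ _ hτ]; ring, by field_simp; ring⟩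
  · intro y _; simp only [add_assoc, ← add_smul, neg_add_cancel, zero_smul, add_zero]
  · intro y _; simp only [add_assoc, ← add_smul, add_neg_cancel, zero_smul, add_zero]

lemma chi_neg (hp4 : p % 4 = 3) (z : ZMod p) :
    quadraticChar (ZMod p) (-z) = - quadraticChar (ZMod p) z := by
  have h1 : quadraticChar (ZMod p) (-1) = -1 := by
    have h0 : (-1 : ZMod p) ≠ 0 := by simp
    rcases quadraticChar_dichotomy h0 with h | h
    · rw [quadraticChar_one_iff_isSquare h0, ZMod.exists_sq_eq_neg_one_iff] at h
      exact absurd hp4 h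
    · exact h
  rw [← neg_one_mul, map_mul, h1, neg_one_mul]

lemma hcount_same (a : F) (ρ τ : ZMod p) (hρ : ρ ≠ 0) (hτ : τ ≠ 0)
    (h : quadraticChar (ZMod p) ρ = quadraticChar (ZMod p) τ) :
    hcount p F a ρ = hcount p F a τ := by
  have h1 : quadraticChar (ZMod p) (ρ * τ) = 1 := by
    rw [map_mul, h]
    rcases quadraticChar_dichotomy hτ with h | h <;> rw [h] <;> norm_num
  rw [quadraticChar_one_iff_isSquare (mul_ne_zero hρ hτ)] at h1
  obtain ⟨s, hs⟩ := h1
  have hs0 : s ≠ 0 := by rintro rfl; simp [hρ, hτ] at hs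
  rw [← hcount_scale a τ (s / τ) (div_ne_zero hs0 hτ)]
  congr 1
  field_simp
  rw [hs]; ring

lemma hcount_sum (a : F) : ∑ ρ : ZMod p, hcount p F a ρ
    = (Finset.univ.filter (fun x : F => tr x = 0)).card := by
  unfold hcount
  rw [← Finset.card_eq_sum_card_fiberwise (f := fun x : F => tr (a * x ^ 2)) (t := Finset.univ)
    (fun _ _ => by simp)]

lemma hcount_sq_sum {q : ℕ} (hc : Fintype.card F = p * p * (q * q))
    (hp2 : (2 : ZMod p) ≠ 0) (a : F) (ha : a ≠ 0) (hτ : tr a⁻¹ ≠ 0) :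
    ∑ ρ : ZMod p, (hcount p F a ρ) ^ 2 = p * (q * q) + (p * (q * q) - 1) * (q * q) := by
  unfold hcount
  rw [sq_count hp2]
  · rw [← Finset.add_sum_erase _ _ (show (0 : F) ∈ _ by simp)]
    congr 1
    · simp [card_tr_val hc]
    · rw [Finset.sum_congr rfl (g := fun _ => q * q)]
      · rw [Finset.sum_const, Finset.card_erase_of_mem (by simp), card_tr_val hc, smul_eq_mul]
      · intro u hu
        have hu0 := Finset.ne_of_mem_erase hu
        have hu1 := Finset.mem_of_mem_erase hu
        simp only [Finset.mem_filter, Finset.mem_univ, true_and] at hu1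
        have h1 := card_ker_tr_mul (p := p) (a * u) (by
          intro k hk
          have h2 : u = k • a⁻¹ := by
            rw [Algebra.smul_def, ← hk]; field_simp
          rw [h2, map_smul, smul_eq_mul] at hu1
          rcases mul_eq_zero.mp hu1 with h3 | h3
          · rw [h3, zero_smul] at h2; exact hu0 h2
          · exact hτ h3) 0
        rw [card_tr_val hc] at h1
        exact Nat.eq_of_mul_eq_mul_left (Fact.out : p.Prime).pos h1
  · intro x hx y hy; simp at *; rw [hx, hy, add_zero]
  · intro x hx y hy; simp at *; rw [hx, hy, sub_zero]
  · intro x hx t; simp at *; right; exact hx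

lemma symm_sum (hp4 : p % 4 = 3) (f : ZMod p → ℤ) (τ : ZMod p) (hτ : τ ≠ 0)
    (hf : ∀ ρ σ, ρ ≠ 0 → σ ≠ 0 → quadraticChar (ZMod p) ρ = quadraticChar (ZMod p) σ → f ρ = f σ) :
    2 * ∑ ρ, f ρ = 2 * f 0 + ((p : ℤ) - 1) * (f τ + f (-τ)) := by
  have e : ∑ ρ, f (-ρ) = ∑ ρ, f ρ := Equiv.sum_comp (Equiv.neg (ZMod p)) f
  have hp := (Fact.out : p.Prime).one_lt
  have h := sum_zmod_split (fun ρ => f ρ + f (-ρ)) (f τ + f (-τ)) (by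
    intro ρ hρ
    rcases quadraticChar_dichotomy hρ with h1 | h1 <;> rcases quadraticChar_dichotomy hτ with h2 | h2
    · rw [hf ρ τ hρ hτ (by rw [h1, h2]), hf (-ρ) (-τ) (by simpa) (by simpa)
        (by rw [chi_neg hp4, chi_neg hp4, h1, h2])]
    · rw [hf ρ (-τ) hρ (by simpa) (by rw [chi_neg hp4, h1, h2]; norm_num), hf (-ρ) τ (by simpa) hτ
        (by rw [chi_neg hp4, h1, h2]), add_comm]
    · rw [hf ρ (-τ) hρ (by simpa) (by rw [chi_neg hp4, h1, h2]), hf (-ρ) τ (by simpa) hτ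
        (by rw [chi_neg hp4, h1, h2]; norm_num), add_comm]
    · rw [hf ρ τ hρ hτ (by rw [h1, h2]), hf (-ρ) (-τ) (by simpa) (by simpa)
        (by rw [chi_neg hp4, chi_neg hp4, h1, h2])])
  rw [Finset.sum_add_distrib, e, nsmul_eq_mul, Nat.cast_sub hp.le, neg_zero] at h
  push_cast at h
  linarith

lemma hcount_val {q : ℕ} (hp4 : p % 4 = 3) (hc : Fintype.card F = p * p * (q * q))
    (hF : ringChar F ≠ 2) (hp2 : (2 : ZMod p) ≠ 0)
    (hsq : ∀ t : ZMod p, t ≠ 0 → quadraticChar F (algebraMap (ZMod p) F t) = 1)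
    (a : F) (ha : a ≠ 0) (hτ : tr a⁻¹ ≠ 0) (E : ℤ) (hE : E = - (quadraticChar F a * Tsum p F 1))
    (ρ : ZMod p) :
    (hcount p F a ρ : ℤ) = q * q - quadraticChar (ZMod p) ρ * quadraticChar (ZMod p) (tr a⁻¹) * E := by
  have hp := (Fact.out : p.Prime).one_lt
  have hpz : (1 : ℤ) < p := by exact_mod_cast hp
  have hE2 : E ^ 2 = (q : ℤ) ^ 2 := by
    rw [hE, neg_sq, mul_pow, Tsum_sq hc hF hp2 hsq]
    rcases quadraticChar_dichotomy ha with h | h <;> rw [h] <;> norm_num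
  have h1 := symm_sum hp4 (fun ρ => (hcount p F a ρ : ℤ)) _ hτ (fun ρ σ h1 h2 h3 => by
    simp only [hcount_same a ρ σ h1 h2 h3])
  have h2 := symm_sum hp4 (fun ρ => (hcount p F a ρ : ℤ) ^ 2) _ hτ (fun ρ σ h1 h2 h3 => by
    simp only [hcount_same a ρ σ h1 h2 h3])
  have h3 := congrArg (Nat.cast : ℕ → ℤ) (n_zero a ha hτ)
  rw [card_quad hF a ha, card_tr_val hc, Tsum_zero hF hsq] at h3
  push_cast [Nat.cast_sub hp.le] at h3
  have h4 := congrArg (Nat.cast : ℕ → ℤ) (hcount_sum (p := p) a)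
  rw [card_tr_val hc] at h4
  have h5 := congrArg (Nat.cast : ℕ → ℤ) (hcount_sq_sum hc hp2 a ha hτ)
  have hpos : 1 ≤ p * (q * q) := by
    rw [← card_tr_val hc 0]; exact Finset.card_pos.mpr ⟨0, by simp⟩
  push_cast [Nat.cast_sub hpos] at h4 h5
  rw [h4] at h1
  rw [h5] at h2
  set A : ℤ := ((hcount p F a 0 : ℕ) : ℤ) with hA
  set B : ℤ := ((hcount p F a (tr a⁻¹) : ℕ) : ℤ) with hB
  set C : ℤ := ((hcount p F a (-tr a⁻¹) : ℕ) : ℤ) with hC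
  have hp1 : (p : ℤ) - 1 ≠ 0 := by linarith
  have e3 : A = q * q - (p - 1) * (C - q * q - E) := by rw [hE]; linear_combination -h3
  have eB : B = C - 2 * E := by
    apply mul_left_cancel₀ hp1
    linear_combination -h1 - 2 * e3
  have eC : (C - q * q - E) ^ 2 = 0 := by
    have : (2 * p * ((p : ℤ) - 1)) ≠ 0 := mul_ne_zero (by linarith) hp1
    apply mul_left_cancel₀ this
    rw [eB, e3] at h2
    linear_combination -h2 - 2 * (p - 1) * hE2
  have eC' : C = q * q + E := by
    have := pow_eq_zero_iff (two_ne_zero) |>.mp eC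
    linarith
  by_cases hρ : ρ = 0
  · subst hρ
    rw [← hA, e3, eC']; simp
  · rcases quadraticChar_dichotomy hρ with k1 | k1 <;> rcases quadraticChar_dichotomy hτ with k2 | k2
    · rw [hcount_same a ρ _ hρ hτ (by rw [k1, k2]), k1, k2, ← hB, eB, eC']; ring
    · rw [hcount_same a ρ (-tr a⁻¹) hρ (by simpa) (by rw [chi_neg hp4, k1, k2]; norm_num), k1, k2,
        ← hC, eC']; ring
    · rw [hcount_same a ρ (-tr a⁻¹) hρ (by simpa) (by rw [chi_neg hp4, k1, k2]), k1, k2,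
        ← hC, eC']; ring
    · rw [hcount_same a ρ _ hρ hτ (by rw [k1, k2]), k1, k2, ← hB, eB, eC']; ring

lemma Nfun_eq (a : F) (ρ : ZMod p) :
    Nfun p F a ρ = (Finset.univ.filter (fun x : F => tr (a * x ^ 2) = ρ ∧
      quadraticChar (ZMod p) (tr x) = 1)).card := by
  unfold Nfun
  rw [← Set.ncard_coe_finset]
  congr 1
  ext x
  simp only [Finset.coe_filter, Finset.mem_univ, true_and, Set.mem_ofPred_eq]
  constructor
  · rintro ⟨⟨_, h1, h2⟩, h3⟩
    exact ⟨h3, (quadraticChar_one_iff_isSquare h2).mpr h1⟩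
  · rintro ⟨h3, h1⟩
    have h2 : tr x ≠ 0 := by intro h; rw [h] at h1; simp at h1
    refine ⟨⟨?_, (quadraticChar_one_iff_isSquare h2).mp h1, h2⟩, h3⟩
    rintro rfl
    simp at h2

lemma Nfun_double (hp4 : p % 4 = 3) (a : F) (ρ : ZMod p) :
    2 * Nfun p F a ρ + hcount p F a ρ
      = (Finset.univ.filter (fun x : F => tr (a * x ^ 2) = ρ)).card := by
  have h1 : (Finset.univ.filter (fun x : F => tr (a * x ^ 2) = ρ ∧
      quadraticChar (ZMod p) (tr x) = -1)).card = Nfun p F a ρ := by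
    rw [Nfun_eq]
    refine Finset.card_nbij' (fun x => -x) (fun x => -x) ?_ ?_ ?_ ?_
    · intro x hx
      simp only [Finset.coe_filter, Finset.mem_univ, true_and, Set.mem_ofPred_eq] at hx ⊢
      rw [neg_sq, map_neg, chi_neg hp4, hx.2]; exact ⟨hx.1, by norm_num⟩
    · intro x hx
      simp only [Finset.coe_filter, Finset.mem_univ, true_and, Set.mem_ofPred_eq] at hx ⊢
      rw [neg_sq, map_neg, chi_neg hp4, hx.2]; exact ⟨hx.1, rfl⟩
    · intro x _; simp
    · intro x _; simp
  rw [two_mul]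
  nth_rewrite 1 [← h1]
  rw [Nfun_eq]
  unfold hcount
  rw [Finset.filter_filter]
  simp only [Finset.card_filter, ← Finset.sum_add_distrib]
  refine Finset.sum_congr rfl fun x _ => ?_
  by_cases hQ : tr (a * x ^ 2) = ρ
  · by_cases h0 : tr x = 0
    · simp [hQ, h0]
    · rcases quadraticChar_dichotomy h0 with h | h <;> simp [hQ, h0, h]
  · simp [hQ]

lemma Nfun_zero {q : ℕ} (hp4 : p % 4 = 3) (hc : Fintype.card F = p * p * (q * q)) (ρ : ZMod p) :
    Nfun p F 0 ρ = if ρ = 0 then (p - 1) / 2 * (p * (q * q)) else 0 := by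
  have h := Nfun_double (F := F) hp4 0 ρ
  unfold hcount at h
  by_cases hρ : ρ = 0
  · subst hρ
    simp only [zero_mul, map_zero, Finset.filter_true, Finset.card_univ, card_tr_val hc, hc] at h
    obtain ⟨k, hk⟩ : ∃ k, p = 2 * k + 1 := ⟨p / 2, by omega⟩
    have hk2 : (p - 1) / 2 = k := by omega
    rw [if_pos rfl, hk2]
    have e : p * p * (q * q) = 2 * (k * (p * (q * q))) + p * (q * q) := by
      nth_rewrite 1 [hk]; ring
    omega
  · simp only [zero_mul, map_zero, Ne.symm hρ, Finset.filter_false, Finset.card_empty] at h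
    rw [if_neg hρ]; omega

lemma Nfun_tau_zero {q : ℕ} (hp4 : p % 4 = 3) (hp2 : (2 : ZMod p) ≠ 0)
    (hc : Fintype.card F = p * p * (q * q)) (a : F) (ha : a ≠ 0) (hτ : tr a⁻¹ = 0) (ρ : ZMod p) :
    Nfun p F a ρ = (p - 1) / 2 * (q * q) := by
  have h := Nfun_double (F := F) hp4 a ρ
  rw [fib_count, sum_zmod_split _ (q * q)] at h
  · have e : ((Finset.univ.filter (fun x : F => tr x = 0)).filter
        (fun x : F => tr (a * x ^ 2) = ρ)).card = hcount p F a ρ := rfl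
    rw [e, smul_eq_mul] at h
    obtain ⟨k, hk⟩ : ∃ k, p - 1 = 2 * k := ⟨p / 2, by omega⟩
    have hk2 : (p - 1) / 2 = k := by omega
    rw [hk2]
    rw [hk, mul_assoc] at h
    omega
  · intro s hs
    have h1 := shift_count (Finset.univ.filter (fun x : F => tr x = s))
      (fun x => tr (a * x ^ 2)) a⁻¹ (2 * s) (mul_ne_zero hp2 hs) (by
        intro x hx t
        simp only [Finset.mem_filter, Finset.mem_univ, true_and] at hx ⊢
        rw [tr_quad_shift a ha, map_add, map_smul, hτ, hx]
        exact ⟨by simp, by ring⟩) ρ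
    rw [card_tr_val hc] at h1
    exact Nat.eq_of_mul_eq_mul_left (Fact.out : p.Prime).pos h1

/-- values of `N_a(ρ)` in the generic case, as an integer identity -/
lemma Nfun_val {q : ℕ} (hp4 : p % 4 = 3) (hc : Fintype.card F = p * p * (q * q))
    (hF : ringChar F ≠ 2) (hp2 : (2 : ZMod p) ≠ 0)
    (hsq : ∀ t : ZMod p, t ≠ 0 → quadraticChar F (algebraMap (ZMod p) F t) = 1)
    (a : F) (ha : a ≠ 0) (hτ : tr a⁻¹ ≠ 0) (E : ℤ) (hE : E = - (quadraticChar F a * Tsum p F 1))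
    (k : ℕ) (hk : p = 2 * k + 1) :
    ((Nfun p F a 0 : ℤ) = k * (q * q + E)) ∧
    ∀ ρ : ZMod p, ρ ≠ 0 →
      (quadraticChar (ZMod p) ρ = quadraticChar (ZMod p) (tr a⁻¹) →
        (Nfun p F a ρ : ℤ) = k * (q * q)) ∧
      (quadraticChar (ZMod p) ρ = - quadraticChar (ZMod p) (tr a⁻¹) →
        (Nfun p F a ρ : ℤ) = k * (q * q) - E) := by
  have key : ∀ ρ : ZMod p, 2 * (Nfun p F a ρ : ℤ) + (q * q - quadraticChar (ZMod p) ρ *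
      quadraticChar (ZMod p) (tr a⁻¹) * E) = (2 * k + 1) * (q * q)
        + quadraticChar F a * Tsum p F ρ := by
    intro ρ
    have h := congrArg (Nat.cast : ℕ → ℤ) (Nfun_double (F := F) hp4 a ρ)
    rw [card_quad hF a ha, card_tr_val hc] at h
    push_cast at h
    rw [hcount_val hp4 hc hF hp2 hsq a ha hτ E hE] at h
    rw [h, show (p : ℤ) = 2 * k + 1 by exact_mod_cast hk]
  have hpk : (p : ℤ) = 2 * k + 1 := by exact_mod_cast hk
  have hτ2 : quadraticChar (ZMod p) (tr a⁻¹) * quadraticChar (ZMod p) (tr a⁻¹) = 1 := by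
    rcases quadraticChar_dichotomy hτ with h | h <;> rw [h] <;> norm_num
  refine ⟨?_, fun ρ hρ => ⟨fun h => ?_, fun h => ?_⟩⟩
  · have h := key 0
    rw [Tsum_zero hF hsq, hpk] at h
    simp only [quadraticChar_zero, zero_mul, sub_zero] at h
    have : (2 : ℤ) * (Nfun p F a 0 : ℤ) = 2 * (k * (q * q + E)) := by
      rw [hE]; linear_combination h
    linarith
  · have h1 := key ρ
    rw [Tsum_mul hsq ρ hρ, h, hτ2] at h1
    rw [hE] at h1
    linarith
  · have h1 := key ρ
    rw [Tsum_mul hsq ρ hρ, h, neg_mul, hτ2] at h1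
    rw [hE] at h1 ⊢
    linarith

lemma eta_inv (a : F) : quadraticChar F a⁻¹ = quadraticChar F a := by
  by_cases ha : a = 0
  · simp [ha]
  have h4 : quadraticChar F a * quadraticChar F a⁻¹ = 1 := by
    rw [← map_mul, mul_inv_cancel₀ ha, map_one]
  rcases quadraticChar_dichotomy ha with h5 | h5 <;> rw [h5] at h4 ⊢ <;> linarith

lemma chi_count (hp4 : p % 4 = 3) (i : ℤ) (hi : i = 1 ∨ i = -1) :
    2 * ((Finset.univ.filter (fun ρ : ZMod p => quadraticChar (ZMod p) ρ = i)).card : ℤ) = p - 1 := by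
  have h := symm_sum hp4 (fun ρ => if quadraticChar (ZMod p) ρ = i then (1 : ℤ) else 0) 1 one_ne_zero
    (fun ρ σ _ _ h => by simp only [h])
  rw [Finset.card_filter]
  push_cast
  rw [h, chi_neg hp4]
  rcases hi with rfl | rfl <;> simp

lemma cnt_aux {q : ℕ} (hp4 : p % 4 = 3) (hc : Fintype.card F = p * p * (q * q))
    (hsq : ∀ t : ZMod p, t ≠ 0 → quadraticChar F (algebraMap (ZMod p) F t) = 1)
    (i e : ℤ) (hi : i = 1 ∨ i = -1) (he : e = 1 ∨ e = -1) :
    4 * ((Finset.univ.filter (fun a : F => quadraticChar (ZMod p) (tr a⁻¹) = i ∧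
      quadraticChar F a = e)).card : ℤ) = (p - 1) * (p * (q * q) + e * Tsum p F 1) := by
  have h1 : (Finset.univ.filter (fun a : F => quadraticChar (ZMod p) (tr a⁻¹) = i ∧
      quadraticChar F a = e)).card = (Finset.univ.filter (fun a : F =>
      quadraticChar (ZMod p) (tr a) = i ∧ quadraticChar F a = e)).card := by
    refine Finset.card_nbij' (fun x => x⁻¹) (fun x => x⁻¹) ?_ ?_ ?_ ?_ <;> intro x hx <;>
      simp only [Finset.coe_filter, Finset.mem_univ, true_and, Set.mem_ofPred_eq, inv_inv,
        eta_inv] at hx ⊢ <;> exact hx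
  rw [h1, Finset.card_eq_sum_card_fiberwise (f := fun a : F => tr a)
    (t := Finset.univ.filter (fun ρ : ZMod p => quadraticChar (ZMod p) ρ = i)) (by
      intro x hx
      simp only [Finset.coe_filter, Finset.mem_univ, true_and, Set.mem_ofPred_eq] at hx ⊢
      exact hx.1)]
  have h2 : ∀ ρ ∈ Finset.univ.filter (fun ρ : ZMod p => quadraticChar (ZMod p) ρ = i),
      2 * ((((Finset.univ.filter (fun a : F => quadraticChar (ZMod p) (tr a) = i ∧
        quadraticChar F a = e)).filter (fun a => tr a = ρ)).card : ℕ) : ℤ)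
        = p * (q * q) + e * Tsum p F 1 := by
    intro ρ hρ
    simp only [Finset.mem_filter, Finset.mem_univ, true_and] at hρ
    have hρ0 : ρ ≠ 0 := by
      rintro rfl
      rw [quadraticChar_zero] at hρ
      omega
    rw [← Tsum_mul hsq ρ hρ0]
    have hcr := card_tr_val hc ρ
    have : ((p : ℤ) * (q * q)) = ((p * (q * q) : ℕ) : ℤ) := by push_cast; ring
    rw [this, ← hcr, Tsum, Finset.mul_sum, Finset.filter_filter]
    simp only [Finset.card_filter, Finset.sum_filter]
    push_cast
    rw [Finset.mul_sum, ← Finset.sum_add_distrib]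
    refine Finset.sum_congr rfl fun y _ => ?_
    by_cases hy : tr y = ρ
    · have hy0 : y ≠ 0 := by rintro rfl; rw [map_zero] at hy; exact hρ0 hy.symm
      rcases quadraticChar_dichotomy hy0 with h | h <;> rcases he with rfl | rfl <;>
        simp [hy, hρ, h]
    · simp [hy]
  have h3 := Finset.sum_congr rfl h2
  rw [← Finset.mul_sum, Finset.sum_const, nsmul_eq_mul] at h3
  push_cast
  have h4 := chi_count hp4 i hi
  linear_combination 2 * h3 + (p * (q * q) + e * Tsum p F 1) * h4

lemma cnt {q : ℕ} (hq : 0 < q) (hp4 : p % 4 = 3) (hc : Fintype.card F = p * p * (q * q))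
    (hF : ringChar F ≠ 2) (hp2 : (2 : ZMod p) ≠ 0)
    (hsq : ∀ t : ZMod p, t ≠ 0 → quadraticChar F (algebraMap (ZMod p) F t) = 1)
    (i e : ℤ) (hi : i = 1 ∨ i = -1) (he : e = 1 ∨ e = -1) :
    4 * ((Finset.univ.filter (fun a : F => quadraticChar (ZMod p) (tr a⁻¹) = i ∧
      - (quadraticChar F a * Tsum p F 1) = e * q)).card : ℤ) = (p - 1) * (p * (q * q) - e * q) := by
  have hq' : (q : ℤ) ≠ 0 := by exact_mod_cast hq.ne'
  rcases sq_eq_sq_iff_eq_or_eq_neg.mp (Tsum_sq hc hF hp2 hsq) with hT | hT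
  · have h := cnt_aux hp4 hc hsq i (-e) hi (by omega)
    have h' : ∀ a : F, - (quadraticChar F a * Tsum p F 1) = e * q ↔ quadraticChar F a = -e := by
      intro a
      rw [hT, ← neg_mul, mul_left_inj' hq', neg_eq_iff_eq_neg]
    simp only [h']
    rw [h, hT]; ring
  · have h := cnt_aux hp4 hc hsq i e hi he
    have h' : ∀ a : F, - (quadraticChar F a * Tsum p F 1) = e * q ↔ quadraticChar F a = e := by
      intro a
      rw [hT, mul_neg, neg_neg, mul_left_inj' hq']
    simp only [h']
    rw [h, hT]; ring

lemma prod_split {M : Type*} [CommMonoid M] (f : ZMod p → M) :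
    ∏ ρ, f ρ = f 0 * ((∏ ρ ∈ Finset.univ.filter (fun ρ : ZMod p => quadraticChar (ZMod p) ρ = 1), f ρ)
      * (∏ ρ ∈ Finset.univ.filter (fun ρ : ZMod p => quadraticChar (ZMod p) ρ = -1), f ρ)) := by
  simp only [Finset.prod_filter]
  have h0 : f 0 = ∏ ρ, if ρ = 0 then f ρ else 1 := by simp
  rw [h0, ← Finset.prod_mul_distrib, ← Finset.prod_mul_distrib]
  refine Finset.prod_congr rfl fun ρ _ => ?_
  by_cases hρ : ρ = 0
  · subst hρ; simp
  · have h1 : ¬ ((-1 : ℤ) = 1) := by norm_num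
    have h2 : ¬ ((1 : ℤ) = -1) := by norm_num
    rcases quadraticChar_dichotomy hρ with h | h <;> simp [h, hρ, h1, h2]

/-- the generic term -/
lemma term_val (a : F) (n0 : ℕ) (g1 g2 : ℕ) (h0 : Nfun p F a 0 = n0)
    (h1 : ∀ ρ : ZMod p, quadraticChar (ZMod p) ρ = 1 → Nfun p F a ρ = g1)
    (h2 : ∀ ρ : ZMod p, quadraticChar (ZMod p) ρ = -1 → Nfun p F a ρ = g2) :
    ∏ ρ : ZMod p, (X ρ : MvPolynomial (ZMod p) ℤ) ^ (Nfun p F a ρ)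
      = X 0 ^ n0 * ((∏ ρ ∈ Finset.univ.filter (fun ρ : ZMod p => quadraticChar (ZMod p) ρ = 1),
            X ρ ^ g1)
          * (∏ ρ ∈ Finset.univ.filter (fun ρ : ZMod p => quadraticChar (ZMod p) ρ = -1),
            X ρ ^ g2)) := by
  rw [prod_split, h0]
  congr 2
  · exact Finset.prod_congr rfl fun ρ hρ => by rw [h1 ρ (Finset.mem_filter.mp hρ).2]
  · exact Finset.prod_congr rfl fun ρ hρ => by rw [h2 ρ (Finset.mem_filter.mp hρ).2]

end helpers

/-- the complete weight enumerator of `C_D` for `p ≡ 3 (mod 4)`, `m` even. -/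
theorem stmt_3 (p m : ℕ) [Fact p.Prime] (hp4 : p % 4 = 3) (hm : 2 ≤ m) (hme : Even m)
    (F : Type) [Field F] [Fintype F] [Algebra (ZMod p) F]
    (hcard : Fintype.card F = p ^ m) :
    CWE p F =
      X 0 ^ ((p - 1) / 2 * p ^ (m - 1))
      + ((p ^ (m - 1) - 1 : ℕ) : MvPolynomial (ZMod p) ℤ)
          * ∏ ρ : ZMod p, X ρ ^ ((p - 1) / 2 * p ^ (m - 2))
      + (((p - 1) * (p ^ (m - 1) + p ^ ((m - 2) / 2)) / 4 : ℕ) : MvPolynomial (ZMod p) ℤ)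
          * X 0 ^ ((p - 1) / 2 * (p ^ (m - 2) - p ^ ((m - 2) / 2)))
          * ((∏ ρ ∈ Finset.univ.filter (fun ρ : ZMod p => quadraticChar (ZMod p) ρ = 1),
                X ρ ^ ((p - 1) / 2 * p ^ (m - 2)))
              * (∏ z ∈ Finset.univ.filter (fun z : ZMod p => quadraticChar (ZMod p) z = -1),
                X z ^ ((p - 1) / 2 * p ^ (m - 2) + p ^ ((m - 2) / 2)))
            + (∏ ρ ∈ Finset.univ.filter (fun ρ : ZMod p => quadraticChar (ZMod p) ρ = -1),
                X ρ ^ ((p - 1) / 2 * p ^ (m - 2)))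
              * (∏ z ∈ Finset.univ.filter (fun z : ZMod p => quadraticChar (ZMod p) z = 1),
                X z ^ ((p - 1) / 2 * p ^ (m - 2) + p ^ ((m - 2) / 2))))
      + (((p - 1) * (p ^ (m - 1) - p ^ ((m - 2) / 2)) / 4 : ℕ) : MvPolynomial (ZMod p) ℤ)
          * X 0 ^ ((p - 1) / 2 * (p ^ (m - 2) + p ^ ((m - 2) / 2)))
          * ((∏ ρ ∈ Finset.univ.filter (fun ρ : ZMod p => quadraticChar (ZMod p) ρ = 1),
                X ρ ^ ((p - 1) / 2 * p ^ (m - 2)))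
              * (∏ z ∈ Finset.univ.filter (fun z : ZMod p => quadraticChar (ZMod p) z = -1),
                X z ^ ((p - 1) / 2 * p ^ (m - 2) - p ^ ((m - 2) / 2)))
            + (∏ ρ ∈ Finset.univ.filter (fun ρ : ZMod p => quadraticChar (ZMod p) ρ = -1),
                X ρ ^ ((p - 1) / 2 * p ^ (m - 2)))
              * (∏ z ∈ Finset.univ.filter (fun z : ZMod p => quadraticChar (ZMod p) z = 1),
                X z ^ ((p - 1) / 2 * p ^ (m - 2) - p ^ ((m - 2) / 2)))) := by
  classical
  obtain ⟨n, hn⟩ : ∃ n, m = 2 * n + 2 := by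
    obtain ⟨j, hj⟩ := hme
    exact ⟨j - 1, by omega⟩
  obtain ⟨q, hqdef⟩ : ∃ q, q = p ^ n := ⟨_, rfl⟩
  have hpp : p.Prime := Fact.out
  have hq : 0 < q := by rw [hqdef]; exact pow_pos hpp.pos n
  have e1 : p ^ (m - 1) = p * (q * q) := by
    rw [hqdef, hn, show 2 * n + 2 - 1 = 1 + n + n by omega]; ring
  have e2 : p ^ (m - 2) = q * q := by
    rw [hqdef, hn, show 2 * n + 2 - 2 = n + n by omega]; ring
  have e3 : p ^ ((m - 2) / 2) = q := by
    rw [hqdef, hn, show (2 * n + 2 - 2) / 2 = n by omega]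
  have hc : Fintype.card F = p * p * (q * q) := by
    rw [hcard, hqdef, hn]; ring
  have hchar : CharP F p := charP_of_injective_algebraMap (algebraMap (ZMod p) F).injective p
  have hF : ringChar F ≠ 2 := by
    rw [ringChar.eq F p]; omega
  have hp2 : (2 : ZMod p) ≠ 0 := by
    intro h
    have h' : ((2 : ℕ) : ZMod p) = 0 := by exact_mod_cast h
    rw [ZMod.natCast_eq_zero_iff] at h'
    have := Nat.le_of_dvd (by norm_num) h'
    omega
  have hsq : ∀ t : ZMod p, t ≠ 0 → quadraticChar F (algebraMap (ZMod p) F t) = 1 := by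
    intro t ht
    refine hsq_of_card (p ^ (n + 1)) (n + 1) rfl hF ?_ ?_ t ht
    · exact Nat.odd_iff.mp ((Nat.odd_iff.mpr (by omega : p % 2 = 1)).pow)
    · rw [hcard, hn]; ring
  rw [e1, e2, e3]
  obtain ⟨k, hk⟩ : ∃ k, p = 2 * k + 1 := ⟨p / 2, by omega⟩
  have hk2 : (p - 1) / 2 = k := by omega
  have hk0 : 1 ≤ k := by omega
  have hqq : q ≤ q * q := Nat.le_mul_of_pos_left q hq
  have hkqq : q ≤ k * (q * q) := le_trans hqq (Nat.le_mul_of_pos_left _ hk0)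
  have hpqq : q ≤ p * (q * q) := le_trans hqq (Nat.le_mul_of_pos_left _ hpp.pos)
  have hq' : (q : ℤ) ≠ 0 := by exact_mod_cast hq.ne'
  have c0 : (Finset.univ.filter (fun a : F => a ≠ 0 ∧ Algebra.trace (ZMod p) F a⁻¹ = 0)).card
      = p * (q * q) - 1 := by
    rw [← card_tr_val (F := F) hc 0, ← Finset.card_erase_of_mem (a := (0 : F)) (by simp)]
    refine Finset.card_nbij' (fun x => x⁻¹) (fun x => x⁻¹) ?_ ?_ ?_ ?_ <;> intro x hx <;>
      simp at hx ⊢ <;> tauto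
  have cm : ∀ i : ℤ, i = 1 ∨ i = -1 → (Finset.univ.filter (fun a : F =>
      quadraticChar (ZMod p) (Algebra.trace (ZMod p) F a⁻¹) = i ∧
      - (quadraticChar F a * Tsum p F 1) = (-1) * q)).card
      = (p - 1) * (p * (q * q) + q) / 4 := by
    intro i hi
    have h := cnt hq hp4 hc hF hp2 hsq i (-1) hi (Or.inr rfl)
    refine (Nat.div_eq_of_eq_mul_right (by norm_num) ?_).symm
    zify [hpp.one_lt.le]
    rw [h]; ring
  have cp : ∀ i : ℤ, i = 1 ∨ i = -1 → (Finset.univ.filter (fun a : F =>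
      quadraticChar (ZMod p) (Algebra.trace (ZMod p) F a⁻¹) = i ∧
      - (quadraticChar F a * Tsum p F 1) = 1 * q)).card
      = (p - 1) * (p * (q * q) - q) / 4 := by
    intro i hi
    have h := cnt hq hp4 hc hF hp2 hsq i 1 hi (Or.inl rfl)
    refine (Nat.div_eq_of_eq_mul_right (by norm_num) ?_).symm
    zify [hpp.one_lt.le, hpqq]
    rw [h]; ring
  rw [hk2]
  let R : ℕ → MvPolynomial (ZMod p) ℤ := fun g =>
    ∏ ρ ∈ Finset.univ.filter (fun ρ : ZMod p => quadraticChar (ZMod p) ρ = 1), X ρ ^ g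
  let S : ℕ → MvPolynomial (ZMod p) ℤ := fun g =>
    ∏ ρ ∈ Finset.univ.filter (fun ρ : ZMod p => quadraticChar (ZMod p) ρ = -1), X ρ ^ g
  have key : ∀ a : F, ∏ ρ : ZMod p, (X ρ : MvPolynomial (ZMod p) ℤ) ^ (Nfun p F a ρ)
      = (if a = 0 then X 0 ^ (k * (p * (q * q))) else 0)
      + (if a ≠ 0 ∧ Algebra.trace (ZMod p) F a⁻¹ = 0 then ∏ ρ : ZMod p, X ρ ^ (k * (q * q)) else 0)
      + (if quadraticChar (ZMod p) (Algebra.trace (ZMod p) F a⁻¹) = 1 ∧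
          - (quadraticChar F a * Tsum p F 1) = (-1) * q then
          X 0 ^ (k * (q * q - q)) * (R (k * (q * q)) * S (k * (q * q) + q)) else 0)
      + (if quadraticChar (ZMod p) (Algebra.trace (ZMod p) F a⁻¹) = -1 ∧
          - (quadraticChar F a * Tsum p F 1) = (-1) * q then
          X 0 ^ (k * (q * q - q)) * (R (k * (q * q) + q) * S (k * (q * q))) else 0)
      + (if quadraticChar (ZMod p) (Algebra.trace (ZMod p) F a⁻¹) = 1 ∧
          - (quadraticChar F a * Tsum p F 1) = 1 * q then
          X 0 ^ (k * (q * q + q)) * (R (k * (q * q)) * S (k * (q * q) - q)) else 0)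
      + (if quadraticChar (ZMod p) (Algebra.trace (ZMod p) F a⁻¹) = -1 ∧
          - (quadraticChar F a * Tsum p F 1) = 1 * q then
          X 0 ^ (k * (q * q + q)) * (R (k * (q * q) - q) * S (k * (q * q))) else 0) := by
    intro a
    by_cases ha : a = 0
    · subst ha
      simp only [Nfun_zero hp4 hc, hk2, pow_ite, pow_zero]
      simp
    by_cases hτ : Algebra.trace (ZMod p) F a⁻¹ = 0
    · simp only [Nfun_tau_zero hp4 hp2 hc a ha hτ, hk2]
      simp [ha, hτ]
    have n1 : ¬ ((-1 : ℤ) = 1) := by norm_num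
    have n2 : ¬ ((1 : ℤ) = -1) := by norm_num
    have n3 : ¬ ((-1 : ℤ) * q = 1 * q) := by rw [mul_left_inj' hq']; norm_num
    have n4 : ¬ ((1 : ℤ) * q = -1 * q) := by rw [mul_left_inj' hq']; norm_num
    have hE : - (quadraticChar F a * Tsum p F 1) = 1 * q ∨
        - (quadraticChar F a * Tsum p F 1) = (-1) * q := by
      rcases sq_eq_sq_iff_eq_or_eq_neg.mp (Tsum_sq hc hF hp2 hsq) with hT | hT <;>
      rcases quadraticChar_dichotomy ha with h | h <;> rw [hT, h] <;> simp
    have ne0 : ∀ (ρ : ZMod p) (i : ℤ), i ≠ 0 → quadraticChar (ZMod p) ρ = i → ρ ≠ 0 := by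
      rintro ρ i hi h rfl
      rw [quadraticChar_zero] at h
      exact hi h.symm
    obtain ⟨v0, v⟩ := Nfun_val hp4 hc hF hp2 hsq a ha hτ _ rfl k hk
    rcases hE with hE | hE <;> rcases quadraticChar_dichotomy hτ with hi | hi <;>
      simp only [ha, hτ, hE, hi, n1, n2, n3, n4, if_true, if_false, and_true, and_false,
        ne_eq, not_false_eq_true, zero_add, add_zero, R, S] <;>
      refine term_val a _ _ _ ?_ ?_ ?_ <;> rw [hE] at v0 v <;> rw [hi] at v
    · zify; rw [v0]; ring
    · intro ρ h; zify; rw [(v ρ (ne0 ρ _ (by norm_num) h)).1 h]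
    · intro ρ h; zify [hkqq]; rw [(v ρ (ne0 ρ _ (by norm_num) h)).2 h]; ring
    · zify; rw [v0]; ring
    · intro ρ h; zify [hkqq]; rw [(v ρ (ne0 ρ _ (by norm_num) h)).2 (by rw [h]; norm_num)]; ring
    · intro ρ h; zify; rw [(v ρ (ne0 ρ _ (by norm_num) h)).1 h]
    · zify [hqq]; rw [v0]; ring
    · intro ρ h; zify; rw [(v ρ (ne0 ρ _ (by norm_num) h)).1 h]
    · intro ρ h; zify; rw [(v ρ (ne0 ρ _ (by norm_num) h)).2 h]; ring
    · zify [hqq]; rw [v0]; ring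
    · intro ρ h; zify; rw [(v ρ (ne0 ρ _ (by norm_num) h)).2 (by rw [h]; norm_num)]; ring
    · intro ρ h; zify; rw [(v ρ (ne0 ρ _ (by norm_num) h)).1 h]
  unfold CWE
  rw [Finset.sum_congr rfl (fun a _ => key a)]
  simp only [Finset.sum_add_distrib]
  simp only [← Finset.sum_filter, Finset.sum_const, c0, cm 1 (Or.inl rfl), cm (-1) (Or.inr rfl),
    cp 1 (Or.inl rfl), cp (-1) (Or.inr rfl), nsmul_eq_mul]
  rw [show (Finset.univ.filter (fun a : F => a = 0)).card = 1 by
    rw [Finset.card_eq_one]; exact ⟨0, by ext; simp⟩]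
  simp only [R, S]
  push_cast
  ring
end

section
/- Suppose p ≡ 1 (mod 4) and m ≥ 3 is odd. Then CWE(C_D) = w_0^{(p−1)p^{m−1}/2} + (p^{m−1}−1)·Π_{ρ∈F_p} w_ρ^{(p−1)p^{m−2}/2} + ((p−1)/8)(p^{m−1}+p^{(m−1)/2}) · Σ_{i=0}^{3} w_0^{((p−1)/2)(p^{m−2}−p^{(m−3)/2})} · [Π_{ρ∈C_i} w_ρ^{A_1}] · [Π_{z∈F_p^*∖C_i} w_z^{B_1}] + ((p−1)/8)(p^{m−1}−p^{(m−1)/2}) · Σ_{i=0}^{3} w_0^{((p−1)/2)(p^{m−2}+p^{(m−3)/2})} · [Π_{ρ∈C_i} w_ρ^{A_{−1}}] · [Π_{z∈F_p^*∖C_i} w_z^{B_{−1}}], where for ε ∈ {1,−1}: A_ε = (p−1)p^{m−2}/2 + (ε/2)(3p^{(m−1)/2} + p^{(m−3)/2}) and B_ε = (p−1)p^{m−2}/2 − (ε/2)(p^{(m−1)/2} − p^{(m−3)/2}). -/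
open MvPolynomial

/-- The cyclotomic class `C_i = β^i ⟨β^4⟩` of order 4 in `F_p^*`
(for `β` a primitive root of `F_p^*`). -/
def cycC (p : ℕ) (β : ZMod p) (i : ℕ) : Finset (ZMod p) :=
  (Finset.range (p - 1)).image fun k => β ^ (i + 4 * k)

section QuadGauss
variable {K : Type} [Field K] [Fintype K] [DecidableEq K]

/-- Quadratic Gauss sum with complex values. -/
noncomputable def qgs (ψ : AddChar K ℂ) : ℂ := ∑ u : K, (quadraticChar K u : ℂ) * ψ u

lemma qgs_sq (h2 : ringChar K ≠ 2) {ψ : AddChar K ℂ} (hψ : ψ.IsPrimitive) :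
    qgs ψ ^ 2 = (quadraticChar K (-1) : ℂ) * (Fintype.card K : ℂ) := by
  have h := gaussSum_sq (χ := (quadraticChar K).ringHomComp (Int.castRingHom ℂ))
    ((MulChar.ringHomComp_ne_one_iff (RingHom.injective_int _)).2 (quadraticChar_ne_one h2))
    ((quadraticChar_isQuadratic K).comp _) hψ
  simpa [gaussSum, qgs] using h

lemma qc_mul_self {a : K} (ha : a ≠ 0) :
    (quadraticChar K a : ℂ) * (quadraticChar K a : ℂ) = 1 := by
  have := quadraticChar_sq_one ha
  rw [← sq]; exact_mod_cast this

lemma qc_inv (a : K) : quadraticChar K a⁻¹ = quadraticChar K a := by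
  by_cases ha : a = 0
  · simp [ha]
  have h1 : quadraticChar K a⁻¹ * quadraticChar K a = 1 := by
    rw [← map_mul, inv_mul_cancel₀ ha, map_one]
  have h2 := quadraticChar_sq_one ha
  rcases quadraticChar_dichotomy ha with h | h <;> rw [h] at h1 ⊢ <;> linarith

lemma qgs_shift (ψ : AddChar K ℂ) {a : K} (ha : a ≠ 0) :
    ∑ u : K, (quadraticChar K u : ℂ) * ψ (a * u) = (quadraticChar K a : ℂ) * qgs ψ := by
  unfold qgs
  rw [← Equiv.sum_comp (Equiv.mulLeft₀ a ha) (fun u => (quadraticChar K u : ℂ) * ψ u), Finset.mul_sum]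
  refine Finset.sum_congr rfl fun u _ => ?_
  simp only [Equiv.mulLeft₀_apply, map_mul, Int.cast_mul]
  linear_combination -(quadraticChar K u : ℂ) * ψ (a * u) * qc_mul_self ha

lemma sum_sq (h2 : ringChar K ≠ 2) (f : K → ℂ) :
    ∑ x : K, f (x ^ 2) = ∑ u : K, ((quadraticChar K u : ℂ) + 1) * f u := by
  rw [← Finset.sum_fiberwise Finset.univ (fun x : K => x ^ 2)]
  refine Finset.sum_congr rfl fun u _ => ?_
  rw [Finset.sum_congr rfl (g := fun _ => f u)
    (fun x hx => by rw [(Finset.mem_filter.1 hx).2])]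
  rw [Finset.sum_const, nsmul_eq_mul]
  congr 1
  have := quadraticChar_card_sqrts h2 u
  have h' : ({x | x ^ 2 = u} : Set K).toFinset = Finset.univ.filter (fun x : K => x ^ 2 = u) := by
    ext; simp
  rw [h'] at this
  exact_mod_cast this

lemma sum_prim_zero {ψ : AddChar K ℂ} (hψ : ψ.IsPrimitive) {a : K} (ha : a ≠ 0) :
    ∑ u : K, ψ (a * u) = 0 := by
  have := AddChar.sum_mulShift a hψ
  simp only [ha, if_false, Nat.cast_zero] at this
  rw [← this]
  exact Finset.sum_congr rfl fun u _ => by rw [mul_comm]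

lemma quad_sum (h2 : ringChar K ≠ 2) {ψ : AddChar K ℂ} (hψ : ψ.IsPrimitive) {a : K} (ha : a ≠ 0)
    (b : K) : ∑ x : K, ψ (a * x ^ 2 + b * x) =
      (quadraticChar K a : ℂ) * qgs ψ * ψ (-(b ^ 2 / (4 * a))) := by
  have two : (2 : K) ≠ 0 := Ring.two_ne_zero h2
  have four : (4 : K) ≠ 0 := by
    have : (4 : K) = 2 * 2 := by norm_num
    rw [this]; exact mul_ne_zero two two
  rw [← (Equiv.subRight (b / (2 * a))).sum_comp]
  have h : ∀ x : K, ψ (a * (Equiv.subRight (b / (2 * a)) x) ^ 2 +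
      b * (Equiv.subRight (b / (2 * a)) x)) = ψ (a * x ^ 2) * ψ (-(b ^ 2 / (4 * a))) := by
    intro x
    rw [← AddChar.map_add_eq_mul]
    congr 1
    simp only [Equiv.subRight_apply]
    field_simp
    ring
  simp only [h]
  rw [← Finset.sum_mul]
  congr 1
  rw [sum_sq h2 (fun u => ψ (a * u))]
  simp only [add_mul, one_mul, Finset.sum_add_distrib]
  rw [sum_prim_zero hψ ha, add_zero, qgs_shift ψ ha]

end QuadGauss

section Setup
set_option linter.unusedSectionVars false
variable {p : ℕ} [Fact p.Prime] {F : Type} [Field F] [Fintype F] [DecidableEq F]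
  [Algebra (ZMod p) F]

/-- The canonical additive character of `F`. -/
noncomputable def psiF (p : ℕ) [Fact p.Prime] (F : Type) [Field F] [Algebra (ZMod p) F] :
    AddChar F ℂ :=
  (ZMod.stdAddChar (N := p)).compAddMonoidHom (Algebra.trace (ZMod p) F).toAddMonoidHom

lemma psiF_apply (x : F) :
    psiF p F x = ZMod.stdAddChar (N := p) (Algebra.trace (ZMod p) F x) := rfl

lemma trace_surj : Function.Surjective (Algebra.trace (ZMod p) F) :=
  Algebra.trace_surjective _ _

lemma psiF_prim : (psiF p F).IsPrimitive := by
  apply AddChar.IsPrimitive.of_ne_one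
  intro h
  obtain ⟨x, hx⟩ := trace_surj (p := p) (F := F) 1
  have h1 : psiF p F x = 1 := by rw [h]; rfl
  rw [psiF_apply, hx] at h1
  have := (ZMod.injective_stdAddChar (N := p)) (h1.trans (AddChar.map_zero_eq_one _).symm)
  exact one_ne_zero this

lemma rc_zmod (hp4 : p % 4 = 1) : ringChar (ZMod p) ≠ 2 := by
  rw [ZMod.ringChar_zmod_n]; rintro rfl; omega

lemma rc_F (hp4 : p % 4 = 1) : ringChar F ≠ 2 := by
  have : CharP F p := charP_of_injective_algebraMap (algebraMap (ZMod p) F).injective p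
  rw [ringChar.eq F p]; rintro rfl; omega

lemma card_half (hp4 : p % 4 = 1) {m : ℕ} (hmo : Odd m) :
    ∃ j, p ^ m / 2 = (p / 2) * (2 * j + 1) := by
  obtain ⟨k, rfl⟩ := hmo
  obtain ⟨n, rfl⟩ : ∃ n, p = 4 * n + 1 := ⟨p / 4, by omega⟩
  have h1 : (4 * n + 1) / 2 = 2 * n := by omega
  rw [h1]
  induction k with
  | zero => exact ⟨0, by simp; omega⟩
  | succ k ih =>
    obtain ⟨j, hj⟩ := ih
    have ho : (4 * n + 1) ^ (2 * k + 1) % 2 = 1 := by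
      rw [Nat.pow_mod]; have : (4 * n + 1) % 2 = 1 := by omega
      rw [this]; simp
    set A := (4 * n + 1) ^ (2 * k + 1) with hA
    have hA2 : A = 2 * (2 * n * (2 * j + 1)) + 1 := by omega
    have e : (4 * n + 1) ^ (2 * (k + 1) + 1) = A * (4 * n + 1) ^ 2 := by
      rw [hA]; ring
    rw [e, hA2]
    refine ⟨j * (4 * n + 1) ^ 2 + 8 * n * n + 6 * n + 1 , ?_⟩
    have : (2 * (2 * n * (2 * j + 1)) + 1) * (4 * n + 1) ^ 2 =
      2 * (2 * n * (2 * (j * (4 * n + 1) ^ 2 + 8 * n * n + 6 * n + 1) + 1)) + 1 := by ring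
    omega

lemma qc_alg (hp4 : p % 4 = 1) {m : ℕ} (hmo : Odd m) (hcard : Fintype.card F = p ^ m)
    (c : ZMod p) : quadraticChar F (algebraMap (ZMod p) F c) = quadraticChar (ZMod p) c := by
  by_cases hc : c = 0
  · simp [hc]
  have hF := quadraticChar_eq_pow_of_char_ne_two' (rc_F (F := F) hp4) (algebraMap (ZMod p) F c)
  have hp := quadraticChar_eq_pow_of_char_ne_two' (rc_zmod (p := p) hp4) c
  obtain ⟨j, hj⟩ := card_half hp4 hmo
  rw [hcard, hj, ← map_pow, pow_mul] at hF
  rw [ZMod.card] at hp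
  rw [← hp] at hF
  have hc' : algebraMap (ZMod p) F c ≠ 0 := by simpa using hc
  have h2 : (2 : F) ≠ 0 := Ring.two_ne_zero (rc_F (F := F) hp4)
  have h11 : (1 : F) ≠ -1 := by
    intro h; apply h2; linear_combination h
  rcases quadraticChar_dichotomy hc with h | h <;>
  rcases quadraticChar_dichotomy hc' with h' | h' <;> rw [h, h'] at hF ⊢ <;>
    simp [pow_succ, pow_mul] at hF
  · exact absurd hF.symm h11
  · exact absurd hF h11

lemma qc_neg_one_zmod (hp4 : p % 4 = 1) : quadraticChar (ZMod p) (-1) = 1 := by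
  rw [quadraticChar_one_iff_isSquare (by simp)]
  exact ZMod.exists_sq_eq_neg_one_iff.2 (by omega)

lemma W_exists (hp4 : p % 4 = 1) {k : ℕ} (hcard : Fintype.card F = p ^ (2 * k + 3)) :
    ∃ s : ℤ, (s = 1 ∨ s = -1) ∧
      qgs (psiF p F) * qgs (ZMod.stdAddChar (N := p)) = (s : ℂ) * (p : ℂ) ^ (k + 2) := by
  have hmo : Odd (2 * k + 3) := ⟨k + 1, by ring⟩
  have h1 := qgs_sq (rc_F (F := F) hp4) (psiF_prim (p := p) (F := F))
  have h2 := qgs_sq (rc_zmod (p := p) hp4) (ZMod.isPrimitive_stdAddChar p)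
  have e : quadraticChar F (-1) = 1 := by
    have := qc_alg (F := F) hp4 hmo hcard (-1)
    rw [map_neg, map_one] at this
    rw [this, qc_neg_one_zmod hp4]
  rw [e, hcard] at h1
  rw [qc_neg_one_zmod hp4, ZMod.card] at h2
  push_cast at h1 h2
  have h3 : (qgs (psiF p F) * qgs (ZMod.stdAddChar (N := p))) ^ 2 = ((p : ℂ) ^ (k + 2)) ^ 2 := by
    rw [mul_pow, h1, h2]; ring
  rcases sq_eq_sq_iff_eq_or_eq_neg.1 h3 with h | h
  · exact ⟨1, Or.inl rfl, by simpa using h⟩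
  · exact ⟨-1, Or.inr rfl, by simpa using h⟩

/-- Number of `x` with prescribed trace of `x` and of `a x^2`. -/
noncomputable def Mfun (p : ℕ) [Fact p.Prime] (F : Type) [Field F] [Fintype F]
    [Algebra (ZMod p) F] (a : F) (t ρ : ZMod p) : ℕ :=
  (Finset.univ.filter fun x : F => Algebra.trace (ZMod p) F (a * x ^ 2) = ρ ∧
    Algebra.trace (ZMod p) F x = t).card

local notation "ψp" => ZMod.stdAddChar (N := p)
local notation "Tr" => Algebra.trace (ZMod p) F

lemma psi_orth (u : ZMod p) : ∑ y : ZMod p, ψp (y * u) = if u = 0 then (p : ℂ) else 0 := by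
  rw [AddChar.sum_mulShift u (ZMod.isPrimitive_stdAddChar p)]
  split_ifs <;> simp [ZMod.card]

lemma tr_smul (z : ZMod p) (x : F) : Tr (algebraMap (ZMod p) F z * x) = z * Tr x := by
  rw [← Algebra.smul_def, map_smul, smul_eq_mul]

lemma Mfun_expand (a : F) (t ρ : ZMod p) : (p : ℂ) ^ 2 * (Mfun p F a t ρ : ℂ) =
    ∑ y : ZMod p, ∑ z : ZMod p, ψp (-(y * ρ) - z * t) *
      ∑ x : F, psiF p F (algebraMap (ZMod p) F y * a * x ^ 2 + algebraMap (ZMod p) F z * x) := by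
  have h : (p : ℂ) ^ 2 * (Mfun p F a t ρ : ℂ) = ∑ x : F,
      (∑ y : ZMod p, ψp (y * (Tr (a * x ^ 2) - ρ))) * (∑ z : ZMod p, ψp (z * (Tr x - t))) := by
    unfold Mfun
    simp only [psi_orth, sub_eq_zero]
    rw [Finset.card_filter]
    push_cast
    rw [Finset.mul_sum]
    refine Finset.sum_congr rfl fun x _ => ?_
    by_cases h1 : Tr (a * x ^ 2) = ρ <;> by_cases h2 : Tr x = t <;> simp [h1, h2, sq]
  rw [h]
  simp only [Finset.sum_mul_sum]
  rw [Finset.sum_comm]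
  refine Finset.sum_congr rfl fun y _ => ?_
  rw [Finset.sum_comm]
  refine Finset.sum_congr rfl fun z _ => ?_
  rw [Finset.mul_sum]
  refine Finset.sum_congr rfl fun x _ => ?_
  rw [psiF_apply, map_add Tr, mul_assoc, tr_smul, tr_smul, ← AddChar.map_add_eq_mul,
    ← AddChar.map_add_eq_mul]
  congr 1; ring

lemma Mfun_main (hp4 : p % 4 = 1) {m : ℕ} (hmo : Odd m) (hcard : Fintype.card F = p ^ m)
    {a : F} (ha : a ≠ 0) (t ρ : ZMod p) : (p : ℂ) ^ 2 * (Mfun p F a t ρ : ℂ) = (p : ℂ) ^ m +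
      (quadraticChar F a : ℂ) * qgs (psiF p F) *
      ∑ y ∈ Finset.univ.erase (0 : ZMod p), (quadraticChar (ZMod p) y : ℂ) * ψp (-(y * ρ)) *
        ∑ z : ZMod p, ψp (-(Tr a⁻¹ / (4 * y)) * z ^ 2 + (-t) * z) := by
  rw [Mfun_expand, ← Finset.add_sum_erase _ _ (Finset.mem_univ (0 : ZMod p))]
  congr 1
  · rw [Finset.sum_eq_single 0]
    · simp [hcard]
    · intro z _ hz
      have : algebraMap (ZMod p) F z ≠ 0 := by simpa using hz
      simp [sum_prim_zero (psiF_prim (p := p) (F := F)) this]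
    · simp
  · rw [Finset.mul_sum]
    refine Finset.sum_congr rfl fun y hy => ?_
    have hy0 : y ≠ 0 := (Finset.mem_erase.1 hy).1
    have hy' : algebraMap (ZMod p) F y ≠ 0 := by simpa using hy0
    rw [Finset.mul_sum, Finset.mul_sum]
    refine Finset.sum_congr rfl fun z _ => ?_
    rw [quad_sum (rc_F (F := F) hp4) psiF_prim (mul_ne_zero hy' ha), map_mul,
      qc_alg hp4 hmo hcard]
    have e : -((algebraMap (ZMod p) F z) ^ 2 / (4 * (algebraMap (ZMod p) F y * a))) =
      algebraMap (ZMod p) F (-(z ^ 2 / (4 * y))) * a⁻¹ := by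
      simp only [map_neg, map_div₀, map_mul, map_pow, map_ofNat]
      rw [div_eq_mul_inv, div_eq_mul_inv, mul_inv, mul_inv, mul_inv]; ring
    rw [psiF_apply, e, tr_smul]
    have e2 : ψp (-(y * ρ) - z * t) * ψp (-(z ^ 2 / (4 * y)) * Tr a⁻¹) =
        ψp (-(y * ρ)) * ψp (-(Tr a⁻¹ / (4 * y)) * z ^ 2 + (-t) * z) := by
      rw [← AddChar.map_add_eq_mul, ← AddChar.map_add_eq_mul]
      congr 1; ring
    push_cast
    linear_combination (quadraticChar (ZMod p) y : ℂ) * (quadraticChar F a : ℂ) *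
      qgs (psiF p F) * e2

lemma Mfun_zero (hp4 : p % 4 = 1) {k : ℕ} (hcard : Fintype.card F = p ^ (2 * k + 3))
    {a : F} (ha : a ≠ 0) {t : ZMod p} (ht : t ≠ 0) (ρ : ZMod p) (hT : Tr a⁻¹ = 0) :
    Mfun p F a t ρ = p ^ (2 * k + 1) := by
  have h := Mfun_main hp4 ⟨k + 1, by ring⟩ hcard ha t ρ
  have hz : ∑ z : ZMod p, ψp ((-t) * z) = 0 :=
    sum_prim_zero (ZMod.isPrimitive_stdAddChar p) (neg_ne_zero.2 ht)
  simp only [hT, zero_div, neg_zero, zero_mul, zero_add, hz, mul_zero, Finset.sum_const_zero,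
    add_zero] at h
  have hp0 : (p : ℂ) ^ 2 ≠ 0 := pow_ne_zero _ (Nat.cast_ne_zero.2 (Fact.out : p.Prime).ne_zero)
  have : (Mfun p F a t ρ : ℂ) = (p : ℂ) ^ (2 * k + 1) := by
    apply mul_left_cancel₀ hp0
    rw [h]; ring
  exact_mod_cast this

lemma Mfun_ne (hp4 : p % 4 = 1) {k : ℕ} (hcard : Fintype.card F = p ^ (2 * k + 3)) {s : ℤ}
    (hs : qgs (psiF p F) * qgs ψp = (s : ℂ) * (p : ℂ) ^ (k + 2))
    {a : F} (ha : a ≠ 0) (t ρ : ZMod p) (hT : Tr a⁻¹ ≠ 0) :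
    (Mfun p F a t ρ : ℤ) = (p : ℤ) ^ (2 * k + 1) +
      s * quadraticChar F a * quadraticChar (ZMod p) (Tr a⁻¹) * (p : ℤ) ^ k *
        ((if t ^ 2 = Tr a⁻¹ * ρ then (p : ℤ) else 0) - 1) := by
  have h := Mfun_main hp4 ⟨k + 1, by ring⟩ hcard ha t ρ
  have two : (2 : ZMod p) ≠ 0 := Ring.two_ne_zero (rc_zmod hp4)
  have four : (4 : ZMod p) ≠ 0 := by
    have : (4 : ZMod p) = 2 * 2 := by norm_num
    rw [this]; exact mul_ne_zero two two
  have qc4 : quadraticChar (ZMod p) 4 = 1 := by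
    rw [quadraticChar_one_iff_isSquare four]; exact ⟨2, by norm_num⟩
  have hsum : ∑ y ∈ Finset.univ.erase (0 : ZMod p),
      (quadraticChar (ZMod p) y : ℂ) * ψp (-(y * ρ)) *
        ∑ z : ZMod p, ψp (-(Tr a⁻¹ / (4 * y)) * z ^ 2 + (-t) * z) =
      (quadraticChar (ZMod p) (Tr a⁻¹) : ℂ) * qgs ψp *
        ((if t ^ 2 = Tr a⁻¹ * ρ then (p : ℂ) else 0) - 1) := by
    have e1 : ∀ y ∈ Finset.univ.erase (0 : ZMod p),
      (quadraticChar (ZMod p) y : ℂ) * ψp (-(y * ρ)) *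
        ∑ z : ZMod p, ψp (-(Tr a⁻¹ / (4 * y)) * z ^ 2 + (-t) * z) =
      (quadraticChar (ZMod p) (Tr a⁻¹) : ℂ) * qgs ψp * ψp (y * (t ^ 2 / Tr a⁻¹ - ρ)) := by
      intro y hy
      have hy0 : y ≠ 0 := (Finset.mem_erase.1 hy).1
      have hc : -(Tr a⁻¹ / (4 * y)) ≠ 0 :=
        neg_ne_zero.2 (div_ne_zero hT (mul_ne_zero four hy0))
      rw [quad_sum (rc_zmod hp4) (ZMod.isPrimitive_stdAddChar p) hc]
      have q : quadraticChar (ZMod p) (-(Tr a⁻¹ / (4 * y))) =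
          quadraticChar (ZMod p) (Tr a⁻¹) * quadraticChar (ZMod p) y := by
        rw [neg_eq_neg_one_mul, map_mul, qc_neg_one_zmod hp4, div_eq_mul_inv, map_mul, qc_inv,
          map_mul, qc4]; ring
      have e2 : ψp (-(y * ρ)) * ψp (-((-t) ^ 2 / (4 * -(Tr a⁻¹ / (4 * y))))) =
          ψp (y * (t ^ 2 / Tr a⁻¹ - ρ)) := by
        rw [← AddChar.map_add_eq_mul]
        congr 1; field_simp; ring
      rw [q, ← e2]
      push_cast
      linear_combination (quadraticChar (ZMod p) (Tr a⁻¹) : ℂ) * qgs ψp * ψp (-(y * ρ)) *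
        ψp (-((-t) ^ 2 / (4 * -(Tr a⁻¹ / (4 * y))))) * qc_mul_self hy0
    rw [Finset.sum_congr rfl e1, ← Finset.mul_sum]
    congr 1
    have := psi_orth (p := p) (t ^ 2 / Tr a⁻¹ - ρ)
    rw [← Finset.add_sum_erase _ _ (Finset.mem_univ (0 : ZMod p)), zero_mul,
      AddChar.map_zero_eq_one] at this
    have e3 : t ^ 2 / Tr a⁻¹ - ρ = 0 ↔ t ^ 2 = Tr a⁻¹ * ρ := by
      rw [sub_eq_zero, div_eq_iff hT, mul_comm]
    simp only [e3] at this
    linear_combination this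
  rw [hsum] at h
  have hp0 : (p : ℂ) ^ 2 ≠ 0 := pow_ne_zero _ (Nat.cast_ne_zero.2 (Fact.out : p.Prime).ne_zero)
  have : (Mfun p F a t ρ : ℂ) = (p : ℂ) ^ (2 * k + 1) +
      s * quadraticChar F a * quadraticChar (ZMod p) (Tr a⁻¹) * (p : ℂ) ^ k *
        ((if t ^ 2 = Tr a⁻¹ * ρ then (p : ℂ) else 0) - 1) := by
    apply mul_left_cancel₀ hp0
    rw [h]
    linear_combination (quadraticChar F a : ℂ) * (quadraticChar (ZMod p) (Tr a⁻¹) : ℂ) *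
      ((if t ^ 2 = Tr a⁻¹ * ρ then (p : ℂ) else 0) - 1) * hs
  have h' : (((Mfun p F a t ρ : ℤ)) : ℂ) = (((p : ℤ) ^ (2 * k + 1) +
      s * quadraticChar F a * quadraticChar (ZMod p) (Tr a⁻¹) * (p : ℤ) ^ k *
        ((if t ^ 2 = Tr a⁻¹ * ρ then (p : ℤ) else 0) - 1) : ℤ) : ℂ) := by
    push_cast
    exact this
  exact_mod_cast h'

/-- Signed and unsigned fibre counts of the trace. -/
lemma fib_card {k : ℕ} (hcard : Fintype.card F = p ^ (k + 1)) (c : ZMod p) :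
    (Finset.univ.filter fun b : F => Tr b = c).card = p ^ k := by
  have h : (p : ℂ) * ((Finset.univ.filter fun b : F => Tr b = c).card : ℂ) =
      ∑ b : F, ∑ y : ZMod p, ψp (y * (Tr b - c)) := by
    simp only [psi_orth, sub_eq_zero]
    rw [Finset.card_filter]
    push_cast
    rw [Finset.mul_sum]
    refine Finset.sum_congr rfl fun x _ => ?_
    split_ifs <;> simp
  rw [Finset.sum_comm, Finset.sum_eq_single 0] at h
  · simp only [zero_mul, AddChar.map_zero_eq_one, Finset.sum_const, Finset.card_univ, hcard,
      nsmul_eq_mul, mul_one] at h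
    have hp0 : (p : ℂ) ≠ 0 := Nat.cast_ne_zero.2 (Fact.out : p.Prime).ne_zero
    have : ((Finset.univ.filter fun b : F => Tr b = c).card : ℂ) = (p : ℂ) ^ k := by
      apply mul_left_cancel₀ hp0
      rw [h]; push_cast; ring
    exact_mod_cast this
  · intro y _ hy
    have hy' : algebraMap (ZMod p) F y ≠ 0 := by simpa using hy
    have := sum_prim_zero (psiF_prim (p := p) (F := F)) hy'
    have e : ∀ b : F, ψp (y * (Tr b - c)) = ψp (-(y * c)) * psiF p F (algebraMap (ZMod p) F y * b) := by
      intro b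
      rw [psiF_apply, tr_smul, ← AddChar.map_add_eq_mul]; congr 1; ring
    simp only [e, ← Finset.mul_sum, this, mul_zero]
  · simp

lemma fib_sum (hp4 : p % 4 = 1) {k : ℕ} (hcard : Fintype.card F = p ^ (2 * k + 3)) {s : ℤ}
    (hs : qgs (psiF p F) * qgs ψp = (s : ℂ) * (p : ℂ) ^ (k + 2)) {c : ZMod p} (hc : c ≠ 0) :
    ∑ b ∈ Finset.univ.filter (fun b : F => Tr b = c), quadraticChar F b =
      s * quadraticChar (ZMod p) c * (p : ℤ) ^ (k + 1) := by
  have h : (p : ℂ) * ∑ b ∈ Finset.univ.filter (fun b : F => Tr b = c), (quadraticChar F b : ℂ) =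
      ∑ b : F, ∑ y : ZMod p, (quadraticChar F b : ℂ) * ψp (y * (Tr b - c)) := by
    simp only [← Finset.mul_sum, psi_orth, sub_eq_zero]
    rw [Finset.sum_filter, Finset.mul_sum]
    refine Finset.sum_congr rfl fun x _ => ?_
    split_ifs <;> simp [mul_comm]
  rw [Finset.sum_comm] at h
  have e : ∀ y : ZMod p, ∑ b : F, (quadraticChar F b : ℂ) * ψp (y * (Tr b - c)) =
      qgs (psiF p F) * ((quadraticChar (ZMod p) y : ℂ) * ψp (-c * y)) := by
    intro y
    have e : ∀ b : F, (quadraticChar F b : ℂ) * ψp (y * (Tr b - c)) = ψp (-c * y) *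
        ((quadraticChar F b : ℂ) * psiF p F (algebraMap (ZMod p) F y * b)) := by
      intro b
      have : ψp (y * (Tr b - c)) = ψp (-c * y) * psiF p F (algebraMap (ZMod p) F y * b) := by
        rw [psiF_apply, tr_smul, ← AddChar.map_add_eq_mul]; congr 1; ring
      rw [this]; ring
    simp only [e, ← Finset.mul_sum]
    by_cases hy : y = 0
    · subst hy
      have := quadraticChar_sum_zero (rc_F (F := F) hp4)
      have : ∑ b : F, (quadraticChar F b : ℂ) = 0 := by exact_mod_cast this
      simp only [map_zero, zero_mul, mul_zero, AddChar.map_zero_eq_one, mul_one, this,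
        MulChar.map_zero, Int.cast_zero]
    · have hy' : algebraMap (ZMod p) F y ≠ 0 := by simpa using hy
      rw [qgs_shift _ hy', qc_alg hp4 ⟨k + 1, by ring⟩ hcard]; ring
  simp only [e, ← Finset.mul_sum] at h
  rw [qgs_shift _ (neg_ne_zero.2 hc), neg_eq_neg_one_mul c, map_mul, qc_neg_one_zmod hp4,
    one_mul] at h
  have hp0 : (p : ℂ) ≠ 0 := Nat.cast_ne_zero.2 (Fact.out : p.Prime).ne_zero
  have : ∑ b ∈ Finset.univ.filter (fun b : F => Tr b = c), (quadraticChar F b : ℂ) =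
      s * quadraticChar (ZMod p) c * (p : ℂ) ^ (k + 1) := by
    apply mul_left_cancel₀ hp0
    rw [h]
    linear_combination (quadraticChar (ZMod p) c : ℂ) * hs
  exact_mod_cast this

end Setup

section Comb
set_option linter.unusedSectionVars false
variable {p : ℕ} [Fact p.Prime] {β : ZMod p}

lemma beta_ne (hβ : IsPrimitiveRoot β (p - 1)) : β ≠ 0 := by
  have h1 := (Fact.out : p.Prime).one_lt
  exact hβ.ne_zero (by omega)

lemma exists_pow (hβ : IsPrimitiveRoot β (p - 1)) {u : ZMod p} (hu : u ≠ 0) :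
    ∃ j < p - 1, β ^ j = u := by
  have h1 := (Fact.out : p.Prime).one_lt
  have : NeZero (p - 1) := ⟨by omega⟩
  exact hβ.eq_pow_of_pow_eq_one (ZMod.pow_card_sub_one_eq_one hu)

lemma mem_cycC (hβ : IsPrimitiveRoot β (p - 1)) (i : ℕ) (u : ZMod p) :
    u ∈ cycC p β i ↔ ∃ k, u = β ^ (i + 4 * k) := by
  have h1 := (Fact.out : p.Prime).one_lt
  unfold cycC
  simp only [Finset.mem_image, Finset.mem_range]
  constructor
  · rintro ⟨k, _, rfl⟩; exact ⟨k, rfl⟩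
  · rintro ⟨k, rfl⟩
    refine ⟨k % (p - 1), Nat.mod_lt _ (by omega), ?_⟩
    have e : i + 4 * k = i + 4 * (k % (p - 1)) + (p - 1) * (4 * (k / (p - 1))) := by
      have := Nat.mod_add_div k (p - 1)
      calc i + 4 * k = i + 4 * (k % (p - 1) + (p - 1) * (k / (p - 1))) := by rw [this]
        _ = _ := by ring
    rw [e, pow_add β (i + 4 * (k % (p - 1))), pow_mul β (p - 1), hβ.pow_eq_one, one_pow, mul_one]

lemma zero_notMem_cycC (hβ : IsPrimitiveRoot β (p - 1)) (i : ℕ) : (0 : ZMod p) ∉ cycC p β i := by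
  rw [mem_cycC hβ]
  rintro ⟨k, hk⟩
  exact pow_ne_zero _ (beta_ne hβ) hk.symm

lemma mul_mem_cycC (hβ : IsPrimitiveRoot β (p - 1)) (j : ℕ) (ρ : ZMod p) :
    (β ^ j)⁻¹ * ρ ∈ cycC p β 0 ↔ ρ ∈ cycC p β (j % 4) := by
  have h1 := (Fact.out : p.Prime).two_le
  have hb := pow_ne_zero j (beta_ne hβ)
  rw [mem_cycC hβ, mem_cycC hβ]
  constructor
  · rintro ⟨k, hk⟩
    refine ⟨j / 4 + k, ?_⟩
    rw [inv_mul_eq_iff_eq_mul₀ hb, ← pow_add] at hk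
    rw [hk]; congr 1; omega
  · rintro ⟨k, hk⟩
    refine ⟨k + (p - 2) * (j / 4), ?_⟩
    rw [inv_mul_eq_iff_eq_mul₀ hb, ← pow_add, hk]
    obtain ⟨P, rfl⟩ : ∃ P, p = P + 2 := ⟨p - 2, by omega⟩
    have e : j + (0 + 4 * (k + (P + 2 - 2) * (j / 4))) =
        (j % 4 + 4 * k) + (P + 2 - 1) * (4 * (j / 4)) := by
      have h3 : P + 2 - 1 = P + 1 := by omega
      have h4 : P + 2 - 2 = P := by omega
      rw [h3, h4]
      have := Nat.mod_add_div j 4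
      calc j + (0 + 4 * (k + P * (j / 4))) = (j % 4 + 4 * (j / 4)) + (0 + 4 * (k + P * (j / 4))) := by
            rw [this]
        _ = _ := by ring
    rw [e, pow_add β (j % 4 + 4 * k), pow_mul β (P + 2 - 1), hβ.pow_eq_one, one_pow, mul_one]

open Classical in
/-- The nonzero squares. -/
noncomputable def SqF (p : ℕ) [Fact p.Prime] : Finset (ZMod p) :=
  Finset.univ.filter fun t => IsSquare t ∧ t ≠ 0

lemma mem_SqF (t : ZMod p) : t ∈ SqF p ↔ IsSquare t ∧ t ≠ 0 := by simp [SqF]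

lemma card_SqF {n : ℕ} (hn : p = 4 * n + 1) : (SqF p).card = 2 * n := by
  have h : (2 : ℤ) * ((SqF p).card : ℤ) =
      ∑ t ∈ Finset.univ.erase (0 : ZMod p), (quadraticChar (ZMod p) t + 1) := by
    have e : SqF p = (Finset.univ.erase (0 : ZMod p)).filter
        (fun t => quadraticChar (ZMod p) t = 1) := by
      ext t
      simp only [mem_SqF, Finset.mem_filter, Finset.mem_erase, Finset.mem_univ, and_true]
      constructor
      · rintro ⟨h, h0⟩; exact ⟨h0, (quadraticChar_one_iff_isSquare h0).2 h⟩
      · rintro ⟨h0, h⟩; exact ⟨(quadraticChar_one_iff_isSquare h0).1 h, h0⟩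
    rw [e, Finset.card_filter]
    push_cast
    rw [Finset.mul_sum]
    refine Finset.sum_congr rfl fun t ht => ?_
    rcases quadraticChar_dichotomy (Finset.mem_erase.1 ht).1 with h | h <;> simp only [h] <;> norm_num
  have hz := quadraticChar_sum_zero (rc_zmod (p := p) (by omega))
  rw [← Finset.add_sum_erase _ _ (Finset.mem_univ (0 : ZMod p)), MulChar.map_zero, zero_add] at hz
  rw [Finset.sum_add_distrib, hz, Finset.sum_const, Finset.card_erase_of_mem (Finset.mem_univ _),
    Finset.card_univ, ZMod.card, zero_add, nsmul_eq_mul, mul_one] at h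
  omega

lemma card_sqrt (hp4 : p % 4 = 1) (hβ : IsPrimitiveRoot β (p - 1)) (u : ZMod p) :
    ((SqF p).filter fun t => t ^ 2 = u).card = if u ∈ cycC p β 0 then 2 else 0 := by
  have two : (2 : ZMod p) ≠ 0 := Ring.two_ne_zero (rc_zmod hp4)
  split_ifs with h
  · rw [mem_cycC hβ] at h
    obtain ⟨k, rfl⟩ := h
    have hb := pow_ne_zero (2 * k) (beta_ne hβ)
    have hm1 : IsSquare (-1 : ZMod p) := ZMod.exists_sq_eq_neg_one_iff.2 (by omega)
    have hs : IsSquare (β ^ (2 * k)) := ⟨β ^ k, by ring⟩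
    have e : ((SqF p).filter fun t => t ^ 2 = β ^ (0 + 4 * k)) = {β ^ (2 * k), -β ^ (2 * k)} := by
      ext t
      have e4 : β ^ (0 + 4 * k) = (β ^ (2 * k)) ^ 2 := by ring
      simp only [Finset.mem_filter, mem_SqF, Finset.mem_insert, Finset.mem_singleton, e4,
        sq_eq_sq_iff_eq_or_eq_neg]
      constructor
      · exact fun h => h.2
      · intro h
        refine ⟨?_, h⟩
        rcases h with rfl | rfl
        · exact ⟨hs, hb⟩
        · refine ⟨?_, neg_ne_zero.2 hb⟩
          rw [neg_eq_neg_one_mul]; exact hm1.mul hs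
    rw [e, Finset.card_pair]
    intro h
    have : 2 * β ^ (2 * k) = 0 := by linear_combination h
    exact (mul_ne_zero two hb) this
  · rw [Finset.card_eq_zero, Finset.filter_eq_empty_iff]
    intro t ht htu
    apply h
    rw [mem_SqF] at ht
    obtain ⟨⟨w, hw⟩, h0⟩ := ht
    have hw0 : w ≠ 0 := by rintro rfl; simp at hw; exact h0 hw
    obtain ⟨j, _, rfl⟩ := exists_pow hβ hw0
    rw [mem_cycC hβ]
    exact ⟨j, by rw [← htu, hw]; ring⟩

lemma sum_mod4 {M : Type} [AddCommMonoid M] (G : ℕ → M) (n : ℕ) :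
    ∑ j ∈ Finset.range (4 * n), G (j % 4) = n • ∑ i ∈ Finset.range 4, G i := by
  induction n with
  | zero => simp
  | succ n ih =>
    rw [mul_add, mul_one, Finset.sum_range_add, ih, succ_nsmul]
    congr 1
    refine Finset.sum_congr rfl fun x hx => ?_
    have := Finset.mem_range.1 hx
    congr 1; omega

lemma sum_classes {M : Type} [AddCommMonoid M] (hβ : IsPrimitiveRoot β (p - 1)) {n : ℕ}
    (hn : p = 4 * n + 1) (H : ZMod p → M) (G : ℕ → M) (hG : ∀ j, H (β ^ j)⁻¹ = G (j % 4)) :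
    ∑ c ∈ Finset.univ.erase (0 : ZMod p), H c = n • ∑ i ∈ Finset.range 4, G i := by
  rw [← sum_mod4]
  simp only [← hG]
  have e : Finset.univ.erase (0 : ZMod p) =
      (Finset.range (4 * n)).image (fun j => (β ^ j)⁻¹) := by
    ext c
    simp only [Finset.mem_erase, Finset.mem_univ, and_true, Finset.mem_image, Finset.mem_range]
    constructor
    · intro hc
      obtain ⟨j, hj, h⟩ := exists_pow hβ (inv_ne_zero hc)
      exact ⟨j, by omega, by rw [h, inv_inv]⟩
    · rintro ⟨j, _, rfl⟩
      exact inv_ne_zero (pow_ne_zero _ (beta_ne hβ))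
  rw [e, Finset.sum_image]
  intro i hi j hj hij
  have hi' : i < 4 * n := by simpa using hi
  have hj' : j < 4 * n := by simpa using hj
  exact hβ.pow_inj (by omega) (by omega) (inv_injective hij)

lemma prod_split_s5 (f : ZMod p → ℕ) {S : Finset (ZMod p)} (hS : (0 : ZMod p) ∉ S) :
    ∏ ρ : ZMod p, (X ρ : MvPolynomial (ZMod p) ℤ) ^ f ρ = X 0 ^ f 0 * (∏ ρ ∈ S, X ρ ^ f ρ) *
      ∏ z ∈ Finset.univ.filter (fun z : ZMod p => z ≠ 0) \ S, X z ^ f z := by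
  rw [← Finset.mul_prod_erase _ _ (Finset.mem_univ (0 : ZMod p)), mul_assoc]
  congr 1
  have e : Finset.univ.erase (0 : ZMod p) = Finset.univ.filter (fun z : ZMod p => z ≠ 0) := by
    ext; simp
  rw [e, mul_comm, Finset.prod_sdiff]
  intro z hz
  simp only [Finset.mem_filter, Finset.mem_univ, true_and]
  rintro rfl; exact hS hz

variable {F : Type} [Field F] [Fintype F] [Algebra (ZMod p) F]

lemma Nfun_eq_s5 (a : F) (ρ : ZMod p) : Nfun p F a ρ = ∑ t ∈ SqF p, Mfun p F a t ρ := by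
  classical
  unfold Nfun Mfun
  have e : {x : F | (x ≠ 0 ∧ IsSquare (Algebra.trace (ZMod p) F x) ∧
      Algebra.trace (ZMod p) F x ≠ 0) ∧ Algebra.trace (ZMod p) F (a * x ^ 2) = ρ} =
      ((Finset.univ.filter fun x : F => Algebra.trace (ZMod p) F x ∈ SqF p ∧
        Algebra.trace (ZMod p) F (a * x ^ 2) = ρ : Finset F) : Set F) := by
    ext x
    simp only [Set.mem_ofPred_eq, Finset.coe_filter, Finset.mem_univ, true_and, mem_SqF]
    constructor
    · rintro ⟨⟨_, h⟩, h'⟩; exact ⟨h, h'⟩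
    · rintro ⟨h, h'⟩
      refine ⟨⟨?_, h⟩, h'⟩
      rintro rfl; exact h.2 (map_zero _)
  rw [e, Set.ncard_coe_finset, Finset.card_eq_sum_card_fiberwise
    (f := fun x => Algebra.trace (ZMod p) F x) (t := SqF p)]
  · refine Finset.sum_congr rfl fun t ht => ?_
    congr 1
    ext x
    simp only [Finset.mem_filter, Finset.mem_univ, true_and]
    constructor
    · rintro ⟨⟨_, h⟩, h'⟩; exact ⟨h, h'⟩
    · rintro ⟨h, h'⟩; exact ⟨⟨h' ▸ ht, h⟩, h'⟩
  · intro x hx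
    simp only [Finset.coe_filter, Finset.mem_univ, true_and, Set.mem_ofPred_eq] at hx
    exact hx.1

lemma Nfun_zero_left {k n : ℕ} (hn : p = 4 * n + 1) (hcard : Fintype.card F = p ^ (k + 1))
    (ρ : ZMod p) : Nfun p F 0 ρ = if ρ = 0 then 2 * n * p ^ k else 0 := by
  classical
  rw [Nfun_eq_s5]
  have : ∀ t ∈ SqF p, Mfun p F 0 t ρ = if ρ = 0 then p ^ k else 0 := by
    intro t _
    unfold Mfun
    split_ifs with h
    · rw [← fib_card hcard t, h]; simp
    · rw [Finset.card_eq_zero, Finset.filter_eq_empty_iff]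
      rintro x _ ⟨h', _⟩
      apply h; rw [← h']; simp
  rw [Finset.sum_congr rfl this, Finset.sum_const, card_SqF hn]
  split_ifs <;> simp

lemma Nfun_T0 {k n : ℕ} (hn : p = 4 * n + 1) (hcard : Fintype.card F = p ^ (2 * k + 3))
    {a : F} (ha : a ≠ 0) (hT : Algebra.trace (ZMod p) F a⁻¹ = 0) (ρ : ZMod p) :
    Nfun p F a ρ = 2 * n * p ^ (2 * k + 1) := by
  classical
  rw [Nfun_eq_s5, Finset.sum_congr rfl (fun t ht =>
    Mfun_zero (by omega) hcard ha ((mem_SqF t).1 ht).2 ρ hT), Finset.sum_const, card_SqF hn,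
    smul_eq_mul]

lemma Nfun_T [DecidableEq F] {k n : ℕ} (hβ : IsPrimitiveRoot β (p - 1)) (hn : p = 4 * n + 1)
    (hcard : Fintype.card F = p ^ (2 * k + 3)) {s : ℤ}
    (hs : qgs (psiF p F) * qgs (ZMod.stdAddChar (N := p)) = (s : ℂ) * (p : ℂ) ^ (k + 2))
    {a : F} (ha : a ≠ 0) (hT : Algebra.trace (ZMod p) F a⁻¹ ≠ 0) (ρ : ZMod p) :
    (Nfun p F a ρ : ℤ) = 2 * n * (p : ℤ) ^ (2 * k + 1) + s * quadraticChar F a *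
      quadraticChar (ZMod p) (Algebra.trace (ZMod p) F a⁻¹) * (p : ℤ) ^ k *
      ((if Algebra.trace (ZMod p) F a⁻¹ * ρ ∈ cycC p β 0 then 2 * (p : ℤ) else 0) - 2 * n) := by
  have h2 := card_sqrt (by omega) hβ (Algebra.trace (ZMod p) F a⁻¹ * ρ)
  rw [Nfun_eq_s5]
  push_cast
  rw [Finset.sum_congr rfl (fun t _ => Mfun_ne (by omega) hcard hs ha t ρ hT),
    Finset.sum_add_distrib, Finset.sum_const, card_SqF hn, ← Finset.mul_sum,
    Finset.sum_sub_distrib, Finset.sum_const, card_SqF hn, ← Finset.sum_filter, Finset.sum_const,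
    h2]
  split_ifs <;> simp

end Comb

section Main
set_option linter.unusedSectionVars false
variable {p : ℕ} [Fact p.Prime] {β : ZMod p}

/-- The common shape of the monomials in the weight enumerator. -/
noncomputable def mono (p : ℕ) [Fact p.Prime] (β : ZMod p) (i u v w : ℕ) :
    MvPolynomial (ZMod p) ℤ :=
  X 0 ^ u * (∏ ρ ∈ cycC p β i, X ρ ^ v) *
    (∏ z ∈ Finset.univ.filter (fun z : ZMod p => z ≠ 0) \ cycC p β i, X z ^ w)

lemma prod_eq_mono (hβ : IsPrimitiveRoot β (p - 1)) (f : ZMod p → ℕ) (i u v w : ℕ)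
    (h0 : f 0 = u) (h1 : ∀ ρ ∈ cycC p β i, f ρ = v)
    (h2 : ∀ ρ, ρ ≠ 0 → ρ ∉ cycC p β i → f ρ = w) :
    ∏ ρ : ZMod p, (X ρ : MvPolynomial (ZMod p) ℤ) ^ f ρ = mono p β i u v w := by
  rw [prod_split_s5 f (zero_notMem_cycC hβ i), mono, h0]
  congr 1
  · congr 1
    exact Finset.prod_congr rfl fun ρ hρ => by rw [h1 ρ hρ]
  · refine Finset.prod_congr rfl fun ρ hρ => ?_
    simp only [Finset.mem_sdiff, Finset.mem_filter, Finset.mem_univ, true_and] at hρ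
    rw [h2 ρ hρ.1 hρ.2]

variable {F : Type} [Field F] [Fintype F] [Algebra (ZMod p) F]

/-- The monomial of a codeword. -/
noncomputable def term (p : ℕ) [Fact p.Prime] (F : Type) [Field F] [Algebra (ZMod p) F] (a : F) :
    MvPolynomial (ZMod p) ℤ := ∏ ρ : ZMod p, X ρ ^ (Nfun p F a ρ)

lemma arith_bounds {k n : ℕ} (hn : p = 4 * n + 1) :
    p ^ k ≤ p ^ (2 * k + 1) ∧ (6 * n + 2) * p ^ k ≤ 2 * n * p ^ (2 * k + 1) ∧
      2 * n * p ^ k ≤ 2 * n * p ^ (2 * k + 1) := by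
  have hpp := (Fact.out : p.Prime).two_le
  have hn1 : 1 ≤ n := by omega
  have e : p ^ (2 * k + 1) = p * (p ^ k * p ^ k) := by ring
  have hq : 1 ≤ p ^ k := Nat.one_le_pow _ _ (by omega)
  have h1 : p * p ^ k ≤ p ^ (2 * k + 1) := by
    rw [e]; apply Nat.mul_le_mul_left
    exact Nat.le_mul_of_pos_left _ hq
  have h2 : p ^ k ≤ p ^ (2 * k + 1) := Nat.pow_le_pow_right (by omega) (by omega)
  refine ⟨h2, ?_, Nat.mul_le_mul_left _ h2⟩
  calc (6 * n + 2) * p ^ k ≤ (2 * n * p) * p ^ k := by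
        apply Nat.mul_le_mul_right
        rw [hn]; nlinarith
    _ = 2 * n * (p * p ^ k) := by ring
    _ ≤ _ := Nat.mul_le_mul_left _ h1

lemma term_pos [DecidableEq F] {k n : ℕ} (hβ : IsPrimitiveRoot β (p - 1)) (hn : p = 4 * n + 1)
    (hcard : Fintype.card F = p ^ (2 * k + 3)) {s : ℤ}
    (hs : qgs (psiF p F) * qgs (ZMod.stdAddChar (N := p)) = (s : ℂ) * (p : ℂ) ^ (k + 2))
    {b : F} (j : ℕ) (hT : Algebra.trace (ZMod p) F b = (β ^ j)⁻¹)
    (he : s * quadraticChar F b * quadraticChar (ZMod p) (Algebra.trace (ZMod p) F b) = 1) :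
    term p F b⁻¹ = mono p β (j % 4) (2 * n * (p ^ (2 * k + 1) - p ^ k))
      (2 * n * p ^ (2 * k + 1) + (6 * n + 2) * p ^ k)
      (2 * n * p ^ (2 * k + 1) - 2 * n * p ^ k) := by
  obtain ⟨hb1, hb2, hb3⟩ := arith_bounds (p := p) (k := k) hn
  have hT0 : Algebra.trace (ZMod p) F b ≠ 0 := by
    rw [hT]; exact inv_ne_zero (pow_ne_zero _ (beta_ne hβ))
  have hb : b ≠ 0 := by rintro rfl; exact hT0 (map_zero _)
  have hN := fun ρ => Nfun_T hβ hn hcard hs (inv_ne_zero hb) (by rwa [inv_inv]) ρ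
  simp only [inv_inv, qc_inv, he] at hN
  simp only [hT, mul_mem_cycC hβ, one_mul] at hN
  have hnz : (p : ℤ) = 4 * n + 1 := by exact_mod_cast hn
  apply prod_eq_mono hβ
  · have := hN 0
    rw [if_neg (zero_notMem_cycC hβ _)] at this
    zify [hb1]
    rw [this]; ring
  · intro ρ hρ
    have := hN ρ
    rw [if_pos hρ] at this
    zify
    rw [this]
    linear_combination 2 * (p : ℤ) ^ k * hnz
  · intro ρ _ hρ
    have := hN ρ
    rw [if_neg hρ] at this
    zify [hb3]
    rw [this]; ring

lemma term_neg [DecidableEq F] {k n : ℕ} (hβ : IsPrimitiveRoot β (p - 1)) (hn : p = 4 * n + 1)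
    (hcard : Fintype.card F = p ^ (2 * k + 3)) {s : ℤ}
    (hs : qgs (psiF p F) * qgs (ZMod.stdAddChar (N := p)) = (s : ℂ) * (p : ℂ) ^ (k + 2))
    {b : F} (j : ℕ) (hT : Algebra.trace (ZMod p) F b = (β ^ j)⁻¹)
    (he : s * quadraticChar F b * quadraticChar (ZMod p) (Algebra.trace (ZMod p) F b) = -1) :
    term p F b⁻¹ = mono p β (j % 4) (2 * n * (p ^ (2 * k + 1) + p ^ k))
      (2 * n * p ^ (2 * k + 1) - (6 * n + 2) * p ^ k)
      (2 * n * p ^ (2 * k + 1) + 2 * n * p ^ k) := by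
  obtain ⟨hb1, hb2, hb3⟩ := arith_bounds (p := p) (k := k) hn
  have hT0 : Algebra.trace (ZMod p) F b ≠ 0 := by
    rw [hT]; exact inv_ne_zero (pow_ne_zero _ (beta_ne hβ))
  have hb : b ≠ 0 := by rintro rfl; exact hT0 (map_zero _)
  have hN := fun ρ => Nfun_T hβ hn hcard hs (inv_ne_zero hb) (by rwa [inv_inv]) ρ
  simp only [inv_inv, qc_inv, he] at hN
  simp only [hT, mul_mem_cycC hβ] at hN
  have hnz : (p : ℤ) = 4 * n + 1 := by exact_mod_cast hn
  apply prod_eq_mono hβ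
  · have := hN 0
    rw [if_neg (zero_notMem_cycC hβ _)] at this
    zify
    rw [this]; ring
  · intro ρ hρ
    have := hN ρ
    rw [if_pos hρ] at this
    zify [hb2]
    rw [this]
    linear_combination -2 * (p : ℤ) ^ k * hnz
  · intro ρ _ hρ
    have := hN ρ
    rw [if_neg hρ] at this
    zify
    rw [this]; ring

lemma fib_term [DecidableEq F] {k n : ℕ} (hβ : IsPrimitiveRoot β (p - 1)) (hn : p = 4 * n + 1)
    (hcard : Fintype.card F = p ^ (2 * k + 3)) {s : ℤ} (hs1 : s = 1 ∨ s = -1)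
    (hs : qgs (psiF p F) * qgs (ZMod.stdAddChar (N := p)) = (s : ℂ) * (p : ℂ) ^ (k + 2))
    {u v : ℕ} (hu : 2 * u = p ^ (2 * k + 2) + p ^ (k + 1))
    (hv : 2 * v + p ^ (k + 1) = p ^ (2 * k + 2)) (j : ℕ) :
    ∑ b ∈ Finset.univ.filter (fun b : F => Algebra.trace (ZMod p) F b = (β ^ j)⁻¹), term p F b⁻¹ =
     (u : MvPolynomial (ZMod p) ℤ) * mono p β (j % 4) (2 * n * (p ^ (2 * k + 1) - p ^ k))
      (2 * n * p ^ (2 * k + 1) + (6 * n + 2) * p ^ k)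
      (2 * n * p ^ (2 * k + 1) - 2 * n * p ^ k) +
     (v : MvPolynomial (ZMod p) ℤ) * mono p β (j % 4) (2 * n * (p ^ (2 * k + 1) + p ^ k))
      (2 * n * p ^ (2 * k + 1) - (6 * n + 2) * p ^ k)
      (2 * n * p ^ (2 * k + 1) + 2 * n * p ^ k) := by
  set c : ZMod p := (β ^ j)⁻¹ with hc
  have hc0 : c ≠ 0 := inv_ne_zero (pow_ne_zero _ (beta_ne hβ))
  set S := Finset.univ.filter (fun b : F => Algebra.trace (ZMod p) F b = c) with hS
  have hSc : S.card = p ^ (2 * k + 2) := fib_card (k := 2 * k + 2) hcard c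
  have hSs := fib_sum (by omega) hcard hs hc0
  rw [← hS] at hSs
  have hmem : ∀ b ∈ S, Algebra.trace (ZMod p) F b = c := fun b hb => (Finset.mem_filter.1 hb).2
  set ε : F → ℤ := fun b => s * quadraticChar F b * quadraticChar (ZMod p) c with hε
  have hqc := quadraticChar_dichotomy hc0
  have hd : ∀ b ∈ S, ε b = 1 ∨ ε b = -1 := by
    intro b hb
    have hb0 : b ≠ 0 := by
      rintro rfl; apply hc0; rw [← hmem _ hb, map_zero]
    have := quadraticChar_dichotomy hb0
    simp only [hε]
    rcases this with h | h <;> rcases hqc with h' | h' <;> rcases hs1 with h'' | h'' <;>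
      simp only [h, h', h''] <;> norm_num
  have hes : ∑ b ∈ S, ε b = (p : ℤ) ^ (k + 1) := by
    simp only [hε, ← Finset.mul_sum, ← Finset.sum_mul]
    rw [hSs]
    rcases hqc with h' | h' <;> rcases hs1 with h'' | h'' <;> simp only [h', h''] <;> ring
  have hcards := Finset.card_filter_add_card_filter_not (s := S) (fun b => ε b = 1)
  have hes2 : ∑ b ∈ S, ε b = ((S.filter fun b => ε b = 1).card : ℤ) -
      ((S.filter fun b => ¬ ε b = 1).card : ℤ) := by
    rw [← Finset.sum_filter_add_sum_filter_not S (fun b => ε b = 1),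
      Finset.sum_congr rfl (g := fun _ => (1 : ℤ)) (fun b hb => (Finset.mem_filter.1 hb).2),
      Finset.sum_congr (s₁ := S.filter fun b => ¬ ε b = 1) rfl (g := fun _ => (-1 : ℤ))
        (fun b hb => (hd b (Finset.mem_filter.1 hb).1).resolve_left (Finset.mem_filter.1 hb).2)]
    simp; ring
  rw [hes] at hes2
  rw [hSc] at hcards
  have hu' : (S.filter fun b => ε b = 1).card = u := by zify at *; linarith
  have hv' : (S.filter fun b => ¬ ε b = 1).card = v := by zify at *; linarith
  rw [← Finset.sum_filter_add_sum_filter_not S (fun b => ε b = 1)]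
  congr 1
  · rw [← hu', ← nsmul_eq_mul]
    apply Finset.sum_eq_card_nsmul
    intro b hb
    obtain ⟨hb1, hb2⟩ := Finset.mem_filter.1 hb
    exact term_pos hβ hn hcard hs j (hmem b hb1) (by rw [hmem b hb1]; exact hb2)
  · rw [← hv', ← nsmul_eq_mul]
    apply Finset.sum_eq_card_nsmul
    intro b hb
    obtain ⟨hb1, hb2⟩ := Finset.mem_filter.1 hb
    exact term_neg hβ hn hcard hs j (hmem b hb1)
      (by rw [hmem b hb1]; exact (hd b hb1).resolve_left hb2)

lemma main_aux {k n : ℕ} (hβ : IsPrimitiveRoot β (p - 1)) (hn : p = 4 * n + 1)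
    (hcard : Fintype.card F = p ^ (2 * k + 3))
    {u v : ℕ} (hu : 2 * u = p ^ (2 * k + 2) + p ^ (k + 1))
    (hv : 2 * v + p ^ (k + 1) = p ^ (2 * k + 2)) :
    CWE p F = X 0 ^ (2 * n * p ^ (2 * k + 2))
      + ((p ^ (2 * k + 2) - 1 : ℕ) : MvPolynomial (ZMod p) ℤ)
          * ∏ ρ : ZMod p, X ρ ^ (2 * n * p ^ (2 * k + 1))
      + ((n * u : ℕ) : MvPolynomial (ZMod p) ℤ) * ∑ i ∈ Finset.range 4,
        mono p β i (2 * n * (p ^ (2 * k + 1) - p ^ k))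
          (2 * n * p ^ (2 * k + 1) + (6 * n + 2) * p ^ k)
          (2 * n * p ^ (2 * k + 1) - 2 * n * p ^ k)
      + ((n * v : ℕ) : MvPolynomial (ZMod p) ℤ) * ∑ i ∈ Finset.range 4,
        mono p β i (2 * n * (p ^ (2 * k + 1) + p ^ k))
          (2 * n * p ^ (2 * k + 1) - (6 * n + 2) * p ^ k)
          (2 * n * p ^ (2 * k + 1) + 2 * n * p ^ k) := by
  classical
  obtain ⟨s, hs1, hs⟩ := W_exists (F := F) (p := p) (by omega) hcard
  have h1 : CWE p F = ∑ b : F, term p F b⁻¹ :=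
    (Equiv.sum_comp (Equiv.inv F) (fun a => term p F a)).symm
  rw [h1, ← Finset.sum_fiberwise Finset.univ (fun b : F => Algebra.trace (ZMod p) F b),
    ← Finset.add_sum_erase _ _ (Finset.mem_univ (0 : ZMod p)),
    sum_classes hβ hn _ (fun i =>
      (u : MvPolynomial (ZMod p) ℤ) * mono p β i (2 * n * (p ^ (2 * k + 1) - p ^ k))
        (2 * n * p ^ (2 * k + 1) + (6 * n + 2) * p ^ k)
        (2 * n * p ^ (2 * k + 1) - 2 * n * p ^ k) +
      (v : MvPolynomial (ZMod p) ℤ) * mono p β i (2 * n * (p ^ (2 * k + 1) + p ^ k))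
        (2 * n * p ^ (2 * k + 1) - (6 * n + 2) * p ^ k)
        (2 * n * p ^ (2 * k + 1) + 2 * n * p ^ k)) (fib_term hβ hn hcard hs1 hs hu hv), add_assoc]
  congr 1
  · have h0 : (0 : F) ∈ Finset.univ.filter (fun b : F => Algebra.trace (ZMod p) F b = 0) := by simp
    rw [← Finset.add_sum_erase _ _ h0]
    congr 1
    · rw [inv_zero, term]
      simp only [Nfun_zero_left hn (k := 2 * k + 2) hcard]
      rw [Finset.prod_eq_single 0]
      · simp
      · intro b _ hb; simp [hb]
      · simp
    · have hc := fib_card (k := 2 * k + 2) hcard (0 : ZMod p)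
      rw [← hc, ← Finset.card_erase_of_mem h0, ← nsmul_eq_mul]
      apply Finset.sum_eq_card_nsmul
      intro b hb
      obtain ⟨hb0, hb1⟩ := Finset.mem_erase.1 hb
      have hT := (Finset.mem_filter.1 hb1).2
      unfold term
      refine Finset.prod_congr rfl fun ρ _ => ?_
      rw [Nfun_T0 hn hcard (inv_ne_zero hb0) (by rwa [inv_inv])]
  · rw [Finset.sum_add_distrib, ← Finset.mul_sum, ← Finset.mul_sum, nsmul_eq_mul]
    push_cast
    ring

end Main

/-- the complete weight enumerator of `C_D` for `p ≡ 1 (mod 4)`,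
`m ≥ 3` odd.  Here `A_ε = (p-1)p^{m-2}/2 + (ε/2)(3 p^{(m-1)/2} + p^{(m-3)/2})` and
`B_ε = (p-1)p^{m-2}/2 - (ε/2)(p^{(m-1)/2} - p^{(m-3)/2})`. -/
theorem stmt_5 (p m : ℕ) [Fact p.Prime] (hp4 : p % 4 = 1) (hm : 3 ≤ m) (hmo : Odd m)
    (F : Type) [Field F] [Fintype F] [Algebra (ZMod p) F]
    (hcard : Fintype.card F = p ^ m)
    (β : ZMod p) (hβ : IsPrimitiveRoot β (p - 1)) :
    CWE p F =
      X 0 ^ ((p - 1) / 2 * p ^ (m - 1))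
      + ((p ^ (m - 1) - 1 : ℕ) : MvPolynomial (ZMod p) ℤ)
          * ∏ ρ : ZMod p, X ρ ^ ((p - 1) / 2 * p ^ (m - 2))
      + (((p - 1) * (p ^ (m - 1) + p ^ ((m - 1) / 2)) / 8 : ℕ) : MvPolynomial (ZMod p) ℤ)
          * ∑ i ∈ Finset.range 4,
              X 0 ^ ((p - 1) / 2 * (p ^ (m - 2) - p ^ ((m - 3) / 2)))
              * (∏ ρ ∈ cycC p β i,
                  X ρ ^ ((p - 1) / 2 * p ^ (m - 2)
                    + (3 * p ^ ((m - 1) / 2) + p ^ ((m - 3) / 2)) / 2))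
              * (∏ z ∈ Finset.univ.filter (fun z : ZMod p => z ≠ 0) \ cycC p β i,
                  X z ^ ((p - 1) / 2 * p ^ (m - 2)
                    - (p ^ ((m - 1) / 2) - p ^ ((m - 3) / 2)) / 2))
      + (((p - 1) * (p ^ (m - 1) - p ^ ((m - 1) / 2)) / 8 : ℕ) : MvPolynomial (ZMod p) ℤ)
          * ∑ i ∈ Finset.range 4,
              X 0 ^ ((p - 1) / 2 * (p ^ (m - 2) + p ^ ((m - 3) / 2)))
              * (∏ ρ ∈ cycC p β i,
                  X ρ ^ ((p - 1) / 2 * p ^ (m - 2)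
                    - (3 * p ^ ((m - 1) / 2) + p ^ ((m - 3) / 2)) / 2))
              * (∏ z ∈ Finset.univ.filter (fun z : ZMod p => z ≠ 0) \ cycC p β i,
                  X z ^ ((p - 1) / 2 * p ^ (m - 2)
                    + (p ^ ((m - 1) / 2) - p ^ ((m - 3) / 2)) / 2)) := by
  obtain ⟨k, rfl⟩ : ∃ k, m = 2 * k + 3 := by
    obtain ⟨l, rfl⟩ := hmo
    exact ⟨l - 1, by omega⟩
  obtain ⟨n, hn⟩ : ∃ n, p = 4 * n + 1 := ⟨p / 4, by omega⟩
  have hpo : Odd p := ⟨2 * n, by omega⟩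
  have hle : p ^ (k + 1) ≤ p ^ (2 * k + 2) :=
    Nat.pow_le_pow_right (Fact.out : p.Prime).pos (by omega)
  have ho1 := Nat.odd_iff.1 (hpo.pow (n := k + 1))
  have ho2 := Nat.odd_iff.1 (hpo.pow (n := 2 * k + 2))
  obtain ⟨u, hu⟩ : ∃ u, 2 * u = p ^ (2 * k + 2) + p ^ (k + 1) :=
    ⟨(p ^ (2 * k + 2) + p ^ (k + 1)) / 2, by omega⟩
  obtain ⟨v, hv⟩ : ∃ v, 2 * v + p ^ (k + 1) = p ^ (2 * k + 2) :=
    ⟨(p ^ (2 * k + 2) - p ^ (k + 1)) / 2, by omega⟩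
  have h := main_aux (F := F) hβ hn hcard hu hv
  have e1 : 2 * k + 3 - 1 = 2 * k + 2 := by omega
  have e2 : 2 * k + 3 - 2 = 2 * k + 1 := by omega
  have e3 : (2 * k + 3 - 3) / 2 = k := by omega
  have e4 : (2 * k + 2) / 2 = k + 1 := by omega
  have e5 : (p - 1) / 2 = 2 * n := by omega
  have hp1 : p - 1 = 4 * n := by omega
  have hpk : p ^ (k + 1) = 4 * (n * p ^ k) + p ^ k := by
    rw [pow_succ]
    calc p ^ k * p = p ^ k * (4 * n + 1) := by rw [← hn]
      _ = _ := by ring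
  have e6 : (3 * p ^ (k + 1) + p ^ k) / 2 = (6 * n + 2) * p ^ k := by
    have : (6 * n + 2) * p ^ k = 6 * (n * p ^ k) + 2 * p ^ k := by ring
    omega
  have e7 : (p ^ (k + 1) - p ^ k) / 2 = 2 * n * p ^ k := by
    have : 2 * n * p ^ k = 2 * (n * p ^ k) := by ring
    omega
  have e8 : (p - 1) * (p ^ (2 * k + 2) + p ^ (k + 1)) / 8 = n * u := by
    rw [← hu, hp1]
    have : 4 * n * (2 * u) = 8 * (n * u) := by ring
    omega
  have e9 : (p - 1) * (p ^ (2 * k + 2) - p ^ (k + 1)) / 8 = n * v := by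
    have hv2 : p ^ (2 * k + 2) - p ^ (k + 1) = 2 * v := by omega
    rw [hv2, hp1]
    have : 4 * n * (2 * v) = 8 * (n * v) := by ring
    omega
  rw [h]
  simp only [e1, e2, e3, e4, e5, e6, e7, e8, e9]
  rfl
end
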